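/- arXiv:2106.05570 — 10 statements merged into one kernel-verified Lean document; each statement's English description precedes it below -/
import Mathlib

section
/- Let (G,R) be a cyclically ordered abelian group such that G is divisible and contains a nonzero element of finite order. Then (G,R) is dense: for every g ≠ 0 there exists h with R(0,h,g). -/
/-- A cyclic order on an (additive) abelian group: a ternary relation that is strict, cyclic,
such that the induced binary relation at each point is transitive and total on distinct triples,
and which is compatible with translation. -/
def IsCyclicOrder {G : Type*} [AddCommGroup G] (R : G → G → G → Prop) : Prop :=
  (∀ a b c : G, R a b c → a ≠ b ∧ b ≠ c ∧ c ≠ a) ∧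
  (∀ a b c : G, R a b c → R b c a) ∧
  (∀ a b c d : G, R a b c → R a c d → R a b d) ∧
  (∀ a b c : G, a ≠ b → b ≠ c → c ≠ a → R a b c ∨ R a c b) ∧
  (∀ a b c x : G, R a b c → R (a + x) (b + x) (c + x))

namespace IsCyclicOrder

variable {G : Type*} [AddCommGroup G] {R : G → G → G → Prop}

theorem asymm (hR : IsCyclicOrder R) {a b c : G} (h : R a b c) : ¬ R a c b :=
  fun h' => (hR.1 _ _ _ (hR.2.2.1 _ _ _ _ h h')).2.1 rfl

theorem rotate (hR : IsCyclicOrder R) {a b c : G} (h : R a b c) : R b c a :=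
  hR.2.1 _ _ _ h

theorem trans (hR : IsCyclicOrder R) {a b c d : G} (h : R a b c) (h' : R a c d) : R a b d :=
  hR.2.2.1 _ _ _ _ h h'

/-- Inserting `c` between `a` and `b` in a cyclic triple `o, a, b`. -/
theorem insert (hR : IsCyclicOrder R) {o a b c : G} (h : R o a b) (h' : R a c b) :
    R o a c ∧ R o c b :=
  ⟨hR.rotate (hR.rotate (hR.trans h' (hR.rotate h))),
    hR.rotate (hR.trans (hR.rotate (hR.rotate h)) (hR.rotate (hR.rotate h')))⟩

theorem translate (hR : IsCyclicOrder R) {a b c a' b' c' : G} (h : R a b c) (x : G)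
    (ha : a + x = a') (hb : b + x = b') (hc : c + x = c') : R a' b' c' := by
  subst ha hb hc
  exact hR.2.2.2.2 _ _ _ _ h

theorem of_not (hR : IsCyclicOrder R) {a b c : G} (hab : a ≠ b) (hbc : b ≠ c) (hca : c ≠ a)
    (h : ¬ R a b c) : R a c b :=
  (hR.2.2.2.1 _ _ _ hab hbc hca).resolve_left h

/-- Adding `w` to `x` passes through `0` relative to `x` only if it does so relative to `w`. -/
theorem not_lt_add_of_add_lt (hR : IsCyclicOrder R) {x w : G} (h : R 0 (x + w) x) :
    ¬ R 0 w (x + w) := by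
  intro h'
  obtain ⟨z, rfl⟩ : ∃ z, x = -z := ⟨-x, (neg_neg x).symm⟩
  have hz : R z w 0 := hR.translate h z (zero_add z) (by abel) (neg_add_cancel z)
  have hzw : R (z + w) w 0 :=
    hR.translate (hR.rotate (hR.rotate (hR.trans (hR.rotate h) (hR.rotate (hR.rotate h'))))) z
      (add_comm w z) (by abel) (neg_add_cancel z)
  have hzz : R z (z + w) 0 :=
    hR.translate (hR.trans h' h) z (zero_add z) (add_comm w z) (neg_add_cancel z)
  have hzww : R (z + w) w z := hR.trans hzw (hR.rotate hzz)
  have hz' : R w (z + w) (w + w) :=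
    hR.translate (hR.rotate (hR.rotate hz)) w (zero_add w) rfl rfl
  have hC : R w 0 (w + w) := hR.trans (hR.rotate hzw) hz'
  have hD : R (z + w) (z + w + w) (w + w) :=
    hR.translate (hR.rotate (hR.rotate hzww)) w rfl rfl rfl
  have hE : R z (z + w) (z + w + w) :=
    hR.rotate (hR.rotate (hR.trans (hR.trans hD (hR.rotate hz')) hzww))
  exact hR.asymm hE (hR.translate (hR.rotate hC) z (zero_add z) (by abel) (add_comm w z))

/-- A nontrivial torsion element has a multiple which is the first nonzero element of the
cyclic subgroup that it generates. -/
theorem exists_first_multiple (hR : IsCyclicOrder R) {t : G} (ht : t ≠ 0)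
    (hfin : IsOfFinAddOrder t) :
    ∃ w : G, w ≠ 0 ∧ IsOfFinAddOrder w ∧ ∀ k : ℕ, ¬ R 0 (k • w) w := by
  have : IsStrictOrder G (R 0) :=
    { irrefl := fun a h => (hR.1 _ _ _ h).2.1 rfl
      trans := fun _ _ _ h h' => hR.trans h h' }
  have hs : ((AddSubmonoid.multiples t : Set G) \ {0}).Finite :=
    (finite_multiples.2 hfin).subset Set.sdiff_subset
  obtain ⟨⟨w, hw, hw0⟩, -, hmin⟩ := (hs.wellFoundedOn (r := R 0)).has_min Set.univ
    ⟨⟨t, AddSubmonoid.mem_multiples t, ht⟩, trivial⟩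
  refine ⟨w, hw0, ?_, fun k hk => hmin ⟨k • w, AddSubmonoid.nsmul_mem _ hw k, ?_⟩ trivial hk⟩
  · obtain ⟨k, rfl⟩ := hw
    exact hfin.nsmul
  · exact (hR.1 _ _ _ hk).1.symm

/-- The multiples of a torsion element `w` cut the cycle into arcs, one of which contains `y`. -/
theorem exists_arc (hR : IsCyclicOrder R) {w y : G} (hw : w ≠ 0) (hfin : IsOfFinAddOrder w)
    (hy : ∀ i : ℕ, y ≠ i • w) : ∃ i : ℕ, R (i • w) y ((i + 1) • w) := by
  by_contra! h
  have hstep (i : ℕ) : R (i • w) ((i + 1) • w) y :=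
    hR.of_not (hy i).symm (hy (i + 1)) (by simpa [add_smul] using hw) (h i)
  have key (i : ℕ) : R 0 ((i + 1) • w) y := by
    induction i with
    | zero => simpa using hstep 0
    | succ i ih => exact (hR.insert ih (hstep (i + 1))).2
  have h0 := key (addOrderOf w - 1)
  rw [Nat.sub_add_cancel hfin.addOrderOf_pos, addOrderOf_nsmul_eq_zero] at h0
  exact (hR.1 _ _ _ h0).1 rfl

/-- If `y` lies strictly before the first nonzero multiple `w` of a torsion element, then adding
`y` to itself `addOrderOf w` times does not go all the way around the cycle. -/
theorem lt_addOrderOf_nsmul (hR : IsCyclicOrder R) {w y : G} (hw : w ≠ 0)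
    (hfin : IsOfFinAddOrder w) (hmin : ∀ k : ℕ, ¬ R 0 (k • w) w) (hy : R 0 y w) :
    R 0 y (addOrderOf w • y) := by
  have hne {i : ℕ} (hi : 0 < i) (hin : i < addOrderOf w) : i • w ≠ 0 := fun h =>
    absurd (addOrderOf_le_of_nsmul_eq_zero hi h) hin.not_ge
  have hn : 1 < addOrderOf w := by
    have := hfin.addOrderOf_pos
    have : addOrderOf w ≠ 1 := fun h => hw (AddMonoid.addOrderOf_eq_one_iff.1 h)
    omega
  have hstep {i : ℕ} (hi : 0 < i) (hin : i < addOrderOf w) (h : R 0 (i • y) (i • w)) :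
      R 0 (i • y) (i • y + w) := by
    have hneg : R 0 (i • y) (-w) := by
      by_cases heq : i • w = -w
      · rwa [← heq]
      · refine hR.trans h (hR.of_not (by simpa [eq_comm] using hw) (Ne.symm heq) (hne hi hin)
          fun h' => hmin (i + 1) ?_)
        exact hR.rotate (hR.translate h' w (zero_add w) (by simp) (succ_nsmul w i).symm)
    refine hR.of_not ?_ ?_ (hR.1 _ _ _ h).1.symm fun h' => hR.not_lt_add_of_add_lt h' ?_
    · intro h0
      exact (hR.1 _ _ _ hneg).2.1 (eq_neg_of_add_eq_zero_left h0.symm)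
    · simpa using hw
    · exact hR.rotate (hR.rotate (hR.translate hneg w (zero_add w) rfl (neg_add_cancel w)))
  have harc (i : ℕ) : R (i • y) ((i + 1) • y) (i • y + w) :=
    hR.translate hy (i • y) (zero_add _) (by rw [succ_nsmul, add_comm]) (add_comm _ _)
  have hP (i : ℕ) (hin : i + 1 < addOrderOf w) : R 0 ((i + 1) • y) ((i + 1) • w) := by
    induction i with
    | zero => simpa using hy
    | succ i ih =>
      have ih := ih (by omega)
      have h1 := hstep i.succ_pos (by omega) ih
      have h2 : R w ((i + 1) • y + w) ((i + 1 + 1) • w) :=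
        hR.translate ih w (zero_add w) rfl (succ_nsmul w _).symm
      have h3 : R 0 w ((i + 1 + 1) • w) :=
        hR.of_not (hne (by omega) hin).symm
          (by rw [succ_nsmul]; simpa only [ne_eq, add_eq_right] using hne i.succ_pos (by omega))
          hw (hmin _)
      exact hR.trans (hR.insert h1 (harc _)).2 (hR.insert h3 h2).2
  have hQ (i : ℕ) (hin : i + 2 ≤ addOrderOf w) : R 0 y ((i + 2) • y) := by
    have hlast (j : ℕ) (hj : j + 1 < addOrderOf w) : R 0 ((j + 1) • y) ((j + 2) • y) :=
      (hR.insert (hstep j.succ_pos hj (hP j hj)) (harc _)).1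
    induction i with
    | zero => simpa using hlast 0 (by omega)
    | succ i ih => exact hR.trans (ih (by omega)) (hlast (i + 1) (by omega))
  simpa [Nat.sub_add_cancel hn] using hQ (addOrderOf w - 2) (by omega)

end IsCyclicOrder

/-- A divisible cyclically ordered abelian group containing a nonzero element of
finite order is dense: for every `g ≠ 0` there exists `h` with `R 0 h g`. -/
theorem dense_of_divisible_with_torsion
    {G : Type*} [AddCommGroup G] (R : G → G → G → Prop) (hR : IsCyclicOrder R)
    (hdiv : ∀ n : ℕ, 1 ≤ n → ∀ a : G, ∃ b : G, n • b = a)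
    (htor : ∃ g : G, g ≠ 0 ∧ IsOfFinAddOrder g) :
    ∀ g : G, g ≠ 0 → ∃ h : G, R 0 h g := by
  intro g hg
  obtain ⟨t, ht, htfin⟩ := htor
  obtain ⟨w, hw, hfin, hmin⟩ := hR.exists_first_multiple ht htfin
  obtain ⟨y, hy⟩ := hdiv (addOrderOf w) hfin.addOrderOf_pos g
  have htors (i : ℕ) : addOrderOf w • i • w = 0 := by
    rw [smul_comm, addOrderOf_nsmul_eq_zero, smul_zero]
  obtain ⟨i, hi⟩ := hR.exists_arc hw hfin (y := y) fun i h => hg (by rw [← hy, h, htors])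
  have hlt : R 0 (y - i • w) w :=
    hR.translate hi (-(i • w)) (add_neg_cancel _) (sub_eq_add_neg _ _).symm
      (by rw [succ_nsmul]; abel)
  refine ⟨y - i • w, ?_⟩
  have h := hR.lt_addOrderOf_nsmul hw hfin hmin hlt
  rwa [smul_sub, hy, htors, sub_zero] at h
end

section
/- The class of c-divisible cyclically ordered abelian groups has the amalgamation property: if (G,R), (G₁,R₁), (G₂,R₂) are cyclically ordered abelian groups, each divisible with a nonzero element of finite order, and φ₁ : (G,R) → (G₁,R₁), φ₂ : (G,R) → (G₂,R₂) are c-embeddings, then there exist a cyclically ordered abelian group (H,S), divisible with a nonzero element of finite order, and c-embeddings ψ₁ : (G₁,R₁) → (H,S), ψ₂ : (G₂,R₂) → (H,S) with ψ₁ ∘ φ₁ = ψ₂ ∘ φ₂. -/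
universe u

/-- A (bundled) cyclically ordered abelian group. -/
structure CycOrdAbGroup : Type (u + 1) where
  carrier : Type u
  [grp : AddCommGroup carrier]
  R : carrier → carrier → carrier → Prop
  cyc : IsCyclicOrder R

attribute [instance] CycOrdAbGroup.grp

/-- A cyclically ordered abelian group is c-divisible when it is divisible and has a nonzero
element of finite order. -/
def CycOrdAbGroup.CDivisible (G : CycOrdAbGroup.{u}) : Prop :=
  (∀ n : ℕ, 1 ≤ n → ∀ a : G.carrier, ∃ b : G.carrier, n • b = a) ∧
  (∃ g : G.carrier, g ≠ 0 ∧ IsOfFinAddOrder g)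

namespace IsCyclicOrder

variable {G : Type*} {R : G → G → G → Prop}

/-- The strict linear order obtained by cutting a cyclic order at `p`, with `p` as least
element. -/
def CutLT (R : G → G → G → Prop) (p x y : G) : Prop := (x = p ∧ y ≠ p) ∨ R p x y

open Classical in
/-- The number of extra turns made by travelling around the circle from `p` to `x` and then
from `x` to `y`, compared with travelling from `p` to `y`. -/
noncomputable def wrap (R : G → G → G → Prop) (p x y : G) : ℤ := if CutLT R p y x then 1 else 0

lemma wrap_congr {G' : Type*} {R' : G' → G' → G' → Prop} {p x y : G} {p' x' y' : G'}
    (H : CutLT R p y x ↔ CutLT R' p' y' x') : wrap R p x y = wrap R' p' x' y' := by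
  unfold wrap
  split_ifs <;> tauto

lemma wrap_nonneg (R : G → G → G → Prop) (p x y : G) : 0 ≤ wrap R p x y := by
  unfold wrap; split_ifs <;> simp

lemma wrap_le_one (R : G → G → G → Prop) (p x y : G) : wrap R p x y ≤ 1 := by
  unfold wrap; split_ifs <;> simp

variable [AddCommGroup G]

lemma not_swap (h : IsCyclicOrder R) {a b c : G} (habc : R a b c) : ¬ R a c b := fun hacb ↦
  (h.1 a b b (h.2.2.1 a b c b habc hacb)).2.1 rfl

lemma wrap_add_wrap (h : IsCyclicOrder R) (x y z w : G) :
    wrap R x y z + wrap R x z w = wrap R y z w + wrap R x y w := by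
  obtain ⟨h1, h2, h3, h4, -⟩ := h
  unfold wrap CutLT
  by_cases hxy : x = y
  · grind
  by_cases hxz : x = z
  · grind
  by_cases hxw : x = w
  · grind
  by_cases hyz : y = z
  · grind
  by_cases hyw : y = w
  · grind
  by_cases hzw : z = w
  · grind
  grind

lemma add_right_iff (h : IsCyclicOrder R) (a b c x : G) :
    R (a + x) (b + x) (c + x) ↔ R a b c :=
  ⟨fun H ↦ by simpa using h.2.2.2.2 _ _ _ (-x) H, h.2.2.2.2 a b c x⟩

lemma wrap_add_right (h : IsCyclicOrder R) (p x y t : G) :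
    wrap R (p + t) (x + t) (y + t) = wrap R p x y := by
  exact wrap_congr (by simp [CutLT, h.add_right_iff])

/-- The cocycle describing the unwinding of a cyclically ordered group. -/
noncomputable def carry (R : G → G → G → Prop) (a b : G) : ℤ := wrap R 0 a (a + b)

lemma carry_nonneg (R : G → G → G → Prop) (a b : G) : 0 ≤ carry R a b := wrap_nonneg ..

lemma carry_le_one (R : G → G → G → Prop) (a b : G) : carry R a b ≤ 1 := wrap_le_one ..

lemma carry_assoc (h : IsCyclicOrder R) (a b c : G) :
    carry R a b + carry R (a + b) c = carry R b c + carry R a (b + c) := by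
  have := h.wrap_add_wrap 0 a (a + b) (a + b + c)
  have h' := h.wrap_add_right 0 b (b + c) a
  rw [zero_add, add_comm b a, show b + c + a = a + b + c by abel] at h'
  simp only [carry, ← add_assoc] at *
  rw [this, h']

lemma neg_swap (h : IsCyclicOrder R) {a b : G} (hab : R 0 a b) : R 0 (-b) (-a) := by
  have key := h.2.2.2.2
  have e1 := key _ _ _ (-a) hab
  have e2 := key _ _ _ (-b) hab
  obtain ⟨h1, h2, h3, h4, -⟩ := h
  obtain ⟨ha, hne, hb⟩ := h1 _ _ _ hab
  refine (h4 0 (-b) (-a) (by simpa using hb) (by simpa using hne.symm)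
    (by simpa using ha.symm)).resolve_right fun hcon ↦ ?_
  have e3 := key _ _ _ a hcon
  have e4 := key _ _ _ b hcon
  simp only [zero_add, add_neg_cancel, neg_add_cancel] at e1 e2 e3 e4
  grind

lemma carry_comm (h : IsCyclicOrder R) (a b : G) : carry R a b = carry R b a := by
  have aux : ∀ a b : G, CutLT R 0 (a + b) a → CutLT R 0 (b + a) b := by
    rintro a b (⟨hab, ha⟩ | hab)
    · refine .inl ⟨by rwa [add_comm], ?_⟩
      rintro rfl
      simp_all
    · right
      have := h.2.2.2.2 _ _ _ (-a) hab
      have := h.neg_swap (h.2.1 _ _ _ (h.2.1 _ _ _ (by simpa using this)))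
      have := h.2.2.2.2 _ _ _ b this
      exact h.2.1 _ _ _ (by simpa [add_comm] using this)
  exact wrap_congr ⟨aux a b, aux b a⟩

lemma carry_zero_left (h : IsCyclicOrder R) (a : G) : carry R 0 a = 0 :=
  if_neg fun H ↦ H.elim (fun H ↦ H.2 rfl) fun H ↦ (h.1 _ _ _ H).2.2 rfl

lemma carry_neg (R : G → G → G → Prop) {a : G} (ha : a ≠ 0) : carry R a (-a) = 1 :=
  if_pos (.inl ⟨add_neg_cancel a, ha⟩)

lemma carry_sub_eq_zero (h : IsCyclicOrder R) {a b : G} (hab : R 0 a b) : carry R a (b - a) = 0 := by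
  refine if_neg ?_
  rw [add_sub_cancel]
  rintro (H | H)
  · exact (h.1 _ _ _ hab).2.2 H.1
  · exact h.not_swap hab H

end IsCyclicOrder

open IsCyclicOrder

/-- The unwinding of a cyclically ordered group: pairs of a winding number and a point. -/
@[ext]
structure Unwinding {G : Type*} [AddCommGroup G] {R : G → G → G → Prop}
    (h : IsCyclicOrder R) where
  wind : ℤ
  point : G

namespace Unwinding

variable {G : Type*} [AddCommGroup G] {R : G → G → G → Prop} {h : IsCyclicOrder R}

noncomputable instance : Add (Unwinding h) :=
  ⟨fun x y ↦ ⟨x.wind + y.wind + carry R x.point y.point, x.point + y.point⟩⟩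

instance : Zero (Unwinding h) := ⟨⟨0, 0⟩⟩

noncomputable instance : Neg (Unwinding h) :=
  ⟨fun x ↦ ⟨-x.wind - carry R x.point (-x.point), -x.point⟩⟩

@[simp] lemma wind_add (x y : Unwinding h) :
    (x + y).wind = x.wind + y.wind + carry R x.point y.point := rfl

@[simp] lemma point_add (x y : Unwinding h) : (x + y).point = x.point + y.point := rfl

@[simp] lemma wind_zero : (0 : Unwinding h).wind = 0 := rfl

@[simp] lemma point_zero : (0 : Unwinding h).point = 0 := rfl

@[simp] lemma wind_neg (x : Unwinding h) :
    (-x).wind = -x.wind - carry R x.point (-x.point) := rfl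

@[simp] lemma point_neg (x : Unwinding h) : (-x).point = -x.point := rfl

noncomputable instance : AddCommGroup (Unwinding h) where
  add_assoc x y z := by
    ext
    · have := h.carry_assoc x.point y.point z.point
      simp only [wind_add, point_add]
      linarith
    · simp [add_assoc]
  zero_add x := by ext <;> simp [h.carry_zero_left]
  add_zero x := by ext <;> simp [h.carry_zero_left, h.carry_comm x.point 0]
  add_comm x y := by
    ext
    · simp only [wind_add, h.carry_comm x.point y.point]
      ring
    · simp [add_comm]
  neg_add_cancel x := by
    ext
    · simp only [wind_add, wind_neg, point_neg, h.carry_comm (-x.point), wind_zero]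
      ring
    · simp
  nsmul := nsmulRec
  zsmul := zsmulRec

variable (h) in
/-- The elements of nonnegative winding number. -/
def cone : AddGroupCone (Unwinding h) where
  carrier := {x | 0 ≤ x.wind}
  zero_mem' := by simp
  add_mem' {x y} hx hy := by
    have := carry_nonneg R x.point y.point
    simp only [Set.mem_ofPred_eq, wind_add] at *
    omega
  eq_zero_of_mem_of_neg_mem' {x} hx hx' := by
    simp only [Set.mem_ofPred_eq, wind_neg] at hx hx'
    have h0 := carry_nonneg R x.point (-x.point)
    by_cases hp : x.point = 0
    · ext
      · rw [wind_zero]; omega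
      · exact hp
    · have := carry_neg R hp
      omega

lemma mem_cone {x : Unwinding h} : x ∈ cone h ↔ 0 ≤ x.wind := by
  change x ∈ {x : Unwinding h | 0 ≤ x.wind} ↔ _
  simp

instance : HasMemOrNegMem (cone h) where
  mem_or_neg_mem x := by
    rw [mem_cone, mem_cone, wind_neg]
    have := carry_le_one R x.point (-x.point)
    omega

open Classical in
noncomputable instance : LinearOrder (Unwinding h) := .mkOfAddGroupCone (cone h)

instance : IsOrderedAddMonoid (Unwinding h) := .mkOfCone (cone h)

lemma le_iff {x y : Unwinding h} : x ≤ y ↔ 0 ≤ (y - x).wind := mem_cone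

lemma nonneg_iff {x : Unwinding h} : 0 ≤ x ↔ 0 ≤ x.wind := by rw [le_iff, sub_zero]

variable (h) in
/-- The elements lying over `0`. -/
def turns : ℤ →+ Unwinding h where
  toFun n := ⟨n, 0⟩
  map_zero' := rfl
  map_add' m n := by ext <;> simp [h.carry_zero_left]

lemma turns_eq_zsmul (n : ℤ) : turns h n = n • turns h 1 := by
  rw [← map_zsmul, smul_eq_mul, mul_one]

lemma turns_pos : 0 < turns h 1 :=
  lt_of_le_of_ne (nonneg_iff.2 zero_le_one) fun H ↦ by simpa [turns] using congrArg wind H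

lemma exists_le_nsmul (x : Unwinding h) : ∃ n : ℕ, x ≤ n • turns h 1 := by
  refine ⟨(x.wind + 2).toNat, ?_⟩
  rw [← natCast_zsmul, ← turns_eq_zsmul, le_iff, sub_eq_add_neg]
  have h1 := carry_le_one R x.point (-x.point)
  have h2 := Int.self_le_toNat (x.wind + 2)
  simp only [turns, AddMonoidHom.coe_mk, ZeroHom.coe_mk, wind_add, wind_neg, point_neg,
    h.carry_zero_left]
  omega

lemma mk_add_mk (a b : G) :
    (⟨0, a⟩ + ⟨0, b⟩ : Unwinding h) = carry R a b • turns h 1 + ⟨0, a + b⟩ := by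
  rw [← turns_eq_zsmul]
  ext <;> simp [turns, h.carry_zero_left]

lemma mk_pos {a : G} (ha : a ≠ 0) : (0 : Unwinding h) < ⟨0, a⟩ :=
  lt_of_le_of_ne (nonneg_iff.2 le_rfl) fun H ↦ ha (congrArg point H).symm

lemma mk_lt_turns (a : G) : (⟨0, a⟩ : Unwinding h) < turns h 1 := by
  by_cases ha : a = 0
  · subst ha; exact turns_pos
  refine lt_of_le_of_ne ?_ fun H ↦ ha (congrArg point H)
  rw [le_iff, sub_eq_add_neg]
  simp [turns, h.carry_zero_left, carry_neg R ha]

lemma mk_lt_mk {a b : G} (hab : R 0 a b) : (⟨0, a⟩ : Unwinding h) < ⟨0, b⟩ := by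
  refine lt_of_le_of_ne ?_ fun H ↦ (h.1 _ _ _ hab).2.1 (congrArg point H)
  have e : (⟨0, b⟩ : Unwinding h) = ⟨0, b - a⟩ + ⟨0, a⟩ := by
    rw [add_comm]
    ext
    · simp [h.carry_sub_eq_zero hab]
    · simp
  rw [e]
  exact le_add_of_nonneg_left (nonneg_iff.2 le_rfl)

section Map

variable {G' : Type*} [AddCommGroup G'] {R' : G' → G' → G' → Prop} (h' : IsCyclicOrder R')

/-- The homomorphism of unwindings induced by a c-embedding. -/
def map (h : IsCyclicOrder R) (φ : G →+ G') (hinj : Function.Injective φ)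
    (hφ : ∀ a b c, R a b c ↔ R' (φ a) (φ b) (φ c)) : Unwinding h →+ Unwinding h' where
  toFun x := ⟨x.wind, φ x.point⟩
  map_zero' := by ext <;> simp
  map_add' x y := by
    have : carry R x.point y.point = carry R' (φ x.point) (φ y.point) :=
      wrap_congr (by simp [CutLT, hφ, ← map_add, map_eq_zero_iff φ hinj])
    ext <;> simp [this]

lemma map_strictMono (φ : G →+ G') (hinj : Function.Injective φ)
    (hφ : ∀ a b c, R a b c ↔ R' (φ a) (φ b) (φ c)) : StrictMono (map h' h φ hinj hφ) := by
  refine Monotone.strictMono_of_injective (fun x y hxy ↦ ?_) fun x y hxy ↦ ?_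
  · rw [← sub_nonneg, ← map_sub]
    rw [← sub_nonneg] at hxy
    exact nonneg_iff.2 (nonneg_iff.1 hxy :)
  · exact Unwinding.ext (congrArg (fun z ↦ z.wind) hxy) (hinj (congrArg (fun z ↦ z.point) hxy))

end Map

end Unwinding

section Amalgamation

/-- Every submonoid `P₀` of an abelian group that contains an element as soon as it contains a
positive multiple of it extends to a total one whose support lies in `P₀`. -/
lemma AddSubmonoid.exists_total_extension {A : Type*} [AddCommGroup A] (P₀ : AddSubmonoid A)
    (hsat : ∀ n : ℕ, 0 < n → ∀ x, n • x ∈ P₀ → x ∈ P₀) :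
    ∃ P : AddSubmonoid A, P₀ ≤ P ∧ (∀ x, x ∈ P ∨ -x ∈ P) ∧ ∀ x ∈ P, -x ∈ P → x ∈ P₀ := by
  obtain ⟨P, hle, hP⟩ := zorn_le_nonempty₀ {P : AddSubmonoid A | ∀ x ∈ P, -x ∈ P → x ∈ P₀}
    (fun c hc hchain y hy ↦ by
      have hmem {x : A} := AddSubmonoid.mem_sSup_of_directedOn ⟨y, hy⟩ hchain.directedOn (x := x)
      refine ⟨sSup c, fun x hx hx' ↦ ?_, fun z hz ↦ le_sSup hz⟩
      obtain ⟨s, hs, hxs⟩ := hmem.1 hx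
      obtain ⟨t, ht, hxt⟩ := hmem.1 hx'
      obtain h | h := hchain.total hs ht
      · exact hc ht x (h hxs) hxt
      · exact hc hs x hxs (h hxt)) P₀ fun x hx _ ↦ hx
  have hPsupp : ∀ x ∈ P, -x ∈ P → x ∈ P₀ := hP.prop
  have key : ∀ x, x ∉ P → ∃ n : ℕ, 0 < n ∧ -(n • x) ∈ P := by
    intro x hx
    by_contra! hcon
    refine hx (hP.le_of_ge (y := P ⊔ closure {x}) (fun y hy hy' ↦ ?_) le_sup_left
      (mem_sup_right (subset_closure rfl)))
    obtain ⟨p, hp, _, hpx, rfl⟩ := mem_sup.1 hy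
    obtain ⟨n, rfl⟩ := mem_closure_singleton.1 hpx
    obtain ⟨q, hq, _, hqx, e⟩ := mem_sup.1 hy'
    obtain ⟨m, rfl⟩ := mem_closure_singleton.1 hqx
    have e' : -((n + m) • x) = p + q := by
      rw [add_smul, neg_add, eq_comm, ← sub_eq_zero]
      have := sub_eq_zero.2 e
      rw [← this]
      abel
    obtain h0 | h0 := Nat.eq_zero_or_pos (n + m)
    · obtain ⟨rfl, rfl⟩ : n = 0 ∧ m = 0 := by omega
      simp only [zero_smul, add_zero] at *
      exact hPsupp p hp (e ▸ hq)
    · exact absurd (e' ▸ P.add_mem hp hq) (hcon _ h0)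
  refine ⟨P, hle, fun x ↦ ?_, hPsupp⟩
  by_contra! hx
  obtain ⟨n, hn, hnx⟩ := key x hx.1
  obtain ⟨m, hm, hmx⟩ := key (-x) hx.2
  rw [smul_neg, neg_neg] at hmx
  refine hx.1 (hle (hsat (n * m) (Nat.mul_pos hn hm) x (hPsupp _ ?_ ?_)))
  · rw [mul_smul]
    exact P.nsmul_mem hmx n
  · rw [mul_comm, mul_smul, ← smul_neg]
    exact P.nsmul_mem hnx m

/-- An abelian group with a total submonoid maps onto a linearly ordered group in which that
submonoid becomes the set of nonnegative elements. -/
lemma AddSubmonoid.exists_linearOrder_quotient {A : Type u} [AddCommGroup A] (P : AddSubmonoid A)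
    (hP : ∀ x, x ∈ P ∨ -x ∈ P) :
    ∃ (L : Type u) (_ : AddCommGroup L) (_ : LinearOrder L) (_ : IsOrderedAddMonoid L)
      (π : A →+ L), Function.Surjective π ∧ ∀ x, 0 ≤ π x ↔ x ∈ P := by
  classical
  let π := QuotientAddGroup.mk' P.support
  have hπ : Function.Surjective π := QuotientAddGroup.mk'_surjective _
  have hmem : ∀ x, π x ∈ P.map π ↔ x ∈ P := by
    refine fun x ↦ ⟨?_, fun hx ↦ AddSubmonoid.mem_map_of_mem π hx⟩
    rintro ⟨y, hy, hyx⟩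
    have : -y + x ∈ P.support := QuotientAddGroup.eq.1 hyx
    simpa using P.add_mem hy this.1
  let C : AddGroupCone (A ⧸ P.support) :=
    { P.map π with
      eq_zero_of_mem_of_neg_mem' := by
        intro a ha ha'
        obtain ⟨x, rfl⟩ := hπ a
        exact (QuotientAddGroup.eq_zero_iff x).2 ⟨(hmem x).1 ha, (hmem (-x)).1 (by simpa using ha')⟩ }
  have hC : ∀ x, π x ∈ C ↔ x ∈ P := hmem
  have : HasMemOrNegMem C := ⟨fun a ↦ by
    obtain ⟨x, rfl⟩ := hπ a
    rw [← map_neg, hC, hC]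
    exact hP x⟩
  let _ : LinearOrder (A ⧸ P.support) := .mkOfAddGroupCone C
  have : IsOrderedAddMonoid (A ⧸ P.support) := .mkOfCone C
  refine ⟨A ⧸ P.support, inferInstance, inferInstance, inferInstance, π, hπ, fun x ↦ ?_⟩
  rw [← hC]
  conv_rhs => rw [← sub_zero (π x)]
  exact Iff.rfl

variable {K K₁ K₂ : Type u} [AddCommGroup K]
  [AddCommGroup K₁] [LinearOrder K₁] [IsOrderedAddMonoid K₁]
  [AddCommGroup K₂] [LinearOrder K₂] [IsOrderedAddMonoid K₂]

/-- The pairs `(a, b)` whose sum is forced to be nonnegative in every ordered group amalgamating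
`K₁` and `K₂` over `K`. -/
def amalgamCone (κ₁ : K →+ K₁) (κ₂ : K →+ K₂) : AddSubmonoid (K₁ × K₂) where
  carrier := {x | ∃ n : ℕ, 0 < n ∧ ∃ k, κ₁ k ≤ n • x.1 ∧ -κ₂ k ≤ n • x.2}
  zero_mem' := ⟨1, one_pos, 0, by simp⟩
  add_mem' := by
    rintro x y ⟨n, hn, k, hx₁, hx₂⟩ ⟨m, hm, l, hy₁, hy₂⟩
    refine ⟨n * m, Nat.mul_pos hn hm, m • k + n • l, ?_, ?_⟩
    · have := add_le_add (nsmul_le_nsmul_right hx₁ m) (nsmul_le_nsmul_right hy₁ n)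
      simpa [smul_smul, mul_comm] using this
    · have := add_le_add (nsmul_le_nsmul_right hx₂ m) (nsmul_le_nsmul_right hy₂ n)
      simpa [smul_smul, mul_comm, add_comm] using this

lemma mem_amalgamCone {κ₁ : K →+ K₁} {κ₂ : K →+ K₂} {x : K₁ × K₂} : x ∈ amalgamCone κ₁ κ₂ ↔
    ∃ n : ℕ, 0 < n ∧ ∃ k, κ₁ k ≤ n • x.1 ∧ -κ₂ k ≤ n • x.2 := Iff.rfl

variable [LinearOrder K]

lemma mk_zero_right_mem_amalgamCone {κ₁ : K →+ K₁} {κ₂ : K →+ K₂} (h₁ : StrictMono κ₁)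
    (h₂ : StrictMono κ₂) {a : K₁} : (a, 0) ∈ amalgamCone κ₁ κ₂ ↔ 0 ≤ a := by
  rw [mem_amalgamCone]
  refine ⟨?_, fun ha ↦ ⟨1, one_pos, 0, by simpa⟩⟩
  rintro ⟨n, hn, k, hk₁, hk₂⟩
  have hk : 0 ≤ k := by
    rw [← h₂.le_iff_le, map_zero]
    simpa using hk₂
  have := (h₁.monotone hk).trans hk₁
  rw [map_zero] at this
  exact (nsmul_nonneg_iff hn.ne').1 this

lemma mk_zero_left_mem_amalgamCone {κ₁ : K →+ K₁} {κ₂ : K →+ K₂} (h₁ : StrictMono κ₁)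
    (h₂ : StrictMono κ₂) {b : K₂} : (0, b) ∈ amalgamCone κ₁ κ₂ ↔ 0 ≤ b := by
  rw [mem_amalgamCone]
  refine ⟨?_, fun hb ↦ ⟨1, one_pos, 0, by simpa⟩⟩
  rintro ⟨n, hn, k, hk₁, hk₂⟩
  have hk : k ≤ 0 := by
    rw [← h₁.le_iff_le, map_zero]
    simpa using hk₁
  have := h₂.monotone hk
  rw [map_zero] at this
  exact (nsmul_nonneg_iff hn.ne').1 ((neg_nonneg.2 this).trans hk₂)

/-- Linearly ordered abelian groups have the amalgamation property. -/
lemma exists_orderedAmalgam (κ₁ : K →+ K₁) (κ₂ : K →+ K₂) (h₁ : StrictMono κ₁)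
    (h₂ : StrictMono κ₂) :
    ∃ (L : Type u) (_ : AddCommGroup L) (_ : LinearOrder L) (_ : IsOrderedAddMonoid L)
      (ι₁ : K₁ →+ L) (ι₂ : K₂ →+ L), StrictMono ι₁ ∧ StrictMono ι₂ ∧
      ι₁.comp κ₁ = ι₂.comp κ₂ ∧ ∀ l, ∃ a b, l = ι₁ a + ι₂ b := by
  obtain ⟨P, hle, htot, hsupp⟩ := (amalgamCone κ₁ κ₂).exists_total_extension <| by
    rintro n hn x ⟨m, hm, k, hk₁, hk₂⟩
    exact ⟨m * n, Nat.mul_pos hm hn, k, by simpa [mul_smul] using hk₁,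
      by simpa [mul_smul] using hk₂⟩
  obtain ⟨L, _, _, _, π, hπ, hmem⟩ := P.exists_linearOrder_quotient htot
  have hnot : ∀ x, x ∈ amalgamCone κ₁ κ₂ → -x ∉ amalgamCone κ₁ κ₂ → 0 < π x := by
    intro x hx hx'
    by_contra! hcon
    refine hx' (hsupp (-x) ?_ (by simpa using hle hx))
    rw [← hmem]
    simpa using hcon
  refine ⟨L, inferInstance, inferInstance, inferInstance, π.comp (AddMonoidHom.inl K₁ K₂),
    π.comp (AddMonoidHom.inr K₁ K₂), ?_, ?_, ?_, ?_⟩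
  · refine fun a b hab ↦ ?_
    rw [← sub_pos, ← map_sub]
    refine hnot _ ((mk_zero_right_mem_amalgamCone h₁ h₂).2 (sub_nonneg.2 hab.le)) fun H ↦ ?_
    have := (mk_zero_right_mem_amalgamCone h₁ h₂ (a := -(b - a))).1 (by simpa using H)
    exact absurd hab (by simpa using this)
  · refine fun a b hab ↦ ?_
    rw [← sub_pos, ← map_sub]
    refine hnot _ ((mk_zero_left_mem_amalgamCone h₁ h₂).2 (sub_nonneg.2 hab.le)) fun H ↦ ?_
    have := (mk_zero_left_mem_amalgamCone h₁ h₂ (b := -(b - a))).1 (by simpa using H)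
    exact absurd hab (by simpa using this)
  · ext k
    have hk : ∀ k, 0 ≤ π (κ₁ k, -κ₂ k) := fun k ↦ (hmem _).2 (hle ⟨1, one_pos, k, by simp⟩)
    have e : ∀ k, π (κ₁ k, -κ₂ k) = π (κ₁ k, 0) - π (0, κ₂ k) := fun k ↦ by
      rw [← map_sub]; simp
    refine sub_eq_zero.1 ((e k).symm.trans (le_antisymm ?_ (hk k)))
    have := hk (-k)
    rwa [map_neg, map_neg, ← Prod.neg_mk, map_neg, neg_nonneg] at this
  · intro l
    obtain ⟨⟨a, b⟩, rfl⟩ := hπ l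
    exact ⟨a, b, by simp [← map_add]⟩

end Amalgamation

section Winding

variable {L : Type*} [AddCommGroup L] {z : L}

lemma coe_eq_coe_iff_exists_zsmul {a b : L} :
    (a : L ⧸ AddSubgroup.zmultiples z) = b ↔ ∃ n : ℤ, b = a + n • z := by
  rw [QuotientAddGroup.eq, AddSubgroup.mem_zmultiples_iff]
  exact exists_congr fun n ↦ by rw [eq_neg_add_iff_add_eq, eq_comm]

variable [LinearOrder L]

/-- The cyclic order obtained by winding a linearly ordered group around a circle of
circumference `z`. -/
def WindingRel (z : L) (x y w : L ⧸ AddSubgroup.zmultiples z) : Prop :=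
  ∃ a b c : L, (a : L ⧸ AddSubgroup.zmultiples z) = x ∧ (b : L ⧸ AddSubgroup.zmultiples z) = y ∧
    (c : L ⧸ AddSubgroup.zmultiples z) = w ∧ a < b ∧ b < c ∧ c < a + z

variable [IsOrderedAddMonoid L]

lemma eq_of_coe_eq_coe (hz : 0 < z) {a b : L} (h : (a : L ⧸ AddSubgroup.zmultiples z) = b)
    (hab : b < a + z) (hba : a < b + z) : a = b := by
  obtain ⟨n, rfl⟩ := coe_eq_coe_iff_exists_zsmul.1 h
  have h1 : n • z < (1 : ℤ) • z := by simpa using hab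
  have h2 : (0 : ℤ) • z < (n + 1) • z := by
    rw [add_assoc] at hba
    simpa [add_smul] using hba
  have := (zsmul_lt_zsmul_iff_left hz).1 h1
  have := (zsmul_lt_zsmul_iff_left hz).1 h2
  obtain rfl : n = 0 := by omega
  simp

lemma exists_coe_eq_of_cofinal (hcof : ∀ l : L, ∃ n : ℕ, l ≤ n • z) (hz : 0 < z) (a : L)
    (x : L ⧸ AddSubgroup.zmultiples z) :
    ∃ b : L, (b : L ⧸ AddSubgroup.zmultiples z) = x ∧ a ≤ b ∧ b < a + z := by
  obtain ⟨b, rfl⟩ := QuotientAddGroup.mk_surjective x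
  obtain ⟨N, hN⟩ := hcof (b - a)
  obtain ⟨M, hM⟩ := hcof (a - b)
  obtain ⟨n, hn, hmax⟩ := Int.exists_greatest_of_bdd (P := fun n : ℤ ↦ n • z ≤ b - a)
    ⟨N, fun n hn ↦ (zsmul_le_zsmul_iff_left hz).1 (hn.trans (by simpa using hN))⟩
    ⟨-M, by simpa using neg_le_neg hM⟩
  refine ⟨b - n • z, coe_eq_coe_iff_exists_zsmul.2 ⟨n, by simp⟩, le_sub_comm.1 hn, ?_⟩
  have : ¬ (n + 1) • z ≤ b - a := fun H ↦ by have := hmax _ H; omega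
  rw [not_le, add_smul, one_smul] at this
  rw [sub_lt_iff_lt_add] at this ⊢
  exact this.trans_eq (by abel)

lemma isCyclicOrder_windingRel (hz : 0 < z) (hcof : ∀ l : L, ∃ n : ℕ, l ≤ n • z) :
    IsCyclicOrder (WindingRel z) := by
  refine ⟨?_, ?_, ?_, ?_, ?_⟩
  · rintro _ _ _ ⟨a, b, c, rfl, rfl, rfl, hab, hbc, hca⟩
    have hc := lt_add_of_pos_right c hz
    have hb := lt_add_of_pos_right b hz
    refine ⟨fun h ↦ hab.ne ?_, fun h ↦ hbc.ne ?_, fun h ↦ (hab.trans hbc).ne' ?_⟩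
    · exact eq_of_coe_eq_coe hz h (hbc.trans hca) (hab.trans hb)
    · exact eq_of_coe_eq_coe hz h (hca.trans (by gcongr)) (hbc.trans hc)
    · exact eq_of_coe_eq_coe hz h ((hab.trans hbc).trans hc) hca
  · rintro _ _ _ ⟨a, b, c, rfl, rfl, rfl, hab, hbc, hca⟩
    exact ⟨b, c, a + z, rfl, rfl, coe_eq_coe_iff_exists_zsmul.2 ⟨-1, by simp⟩, hbc, hca, by gcongr⟩
  · rintro _ _ _ _ ⟨a, b, c, rfl, rfl, rfl, hab, hbc, hca⟩ ⟨a', c', d, ha, hc, rfl, hac, hcd, hda⟩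
    obtain ⟨n, rfl⟩ := coe_eq_coe_iff_exists_zsmul.1 ha
    have hcc : c' + n • z = c := by
      refine eq_of_coe_eq_coe hz (Eq.trans ?_ hc) ?_ ?_
      · exact coe_eq_coe_iff_exists_zsmul.2 ⟨-n, by simp⟩
      · exact hca.trans (by gcongr)
      · calc c' + n • z < a' + z + n • z := by gcongr; exact hcd.trans hda
          _ = a' + n • z + z := by abel
          _ < c + z := by gcongr; exact hab.trans hbc
    refine ⟨a' + n • z, b, d + n • z, rfl, rfl, coe_eq_coe_iff_exists_zsmul.2 ⟨-n, by simp⟩, hab,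
      hbc.trans (hcc ▸ by gcongr), ?_⟩
    rw [add_right_comm]
    gcongr
  · intro x y w hxy hyw hwx
    obtain ⟨a, rfl⟩ := QuotientAddGroup.mk_surjective x
    obtain ⟨b, rfl, hab, hba⟩ := exists_coe_eq_of_cofinal hcof hz a y
    obtain ⟨c, rfl, hac, hca⟩ := exists_coe_eq_of_cofinal hcof hz a w
    have hab := hab.lt_of_ne (by rintro rfl; exact hxy rfl)
    have hac := hac.lt_of_ne (by rintro rfl; exact hwx rfl)
    obtain hbc | rfl | hcb := lt_trichotomy b c
    · exact .inl ⟨a, b, c, rfl, rfl, rfl, hab, hbc, hca⟩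
    · exact absurd rfl hyw
    · exact .inr ⟨a, c, b, rfl, rfl, rfl, hac, hcb, hba⟩
  · rintro _ _ _ x ⟨a, b, c, rfl, rfl, rfl, hab, hbc, hca⟩
    obtain ⟨t, rfl⟩ := QuotientAddGroup.mk_surjective x
    refine ⟨a + t, b + t, c + t, rfl, rfl, rfl, by gcongr, by gcongr, ?_⟩
    rw [add_right_comm]
    gcongr

end Winding

/-- The winding of a linearly ordered group around a cofinal positive element. -/
def CycOrdAbGroup.ofWinding {L : Type u} [AddCommGroup L] [LinearOrder L] [IsOrderedAddMonoid L]
    {z : L} (hz : 0 < z) (hcof : ∀ l : L, ∃ n : ℕ, l ≤ n • z) : CycOrdAbGroup.{u} where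
  carrier := L ⧸ AddSubgroup.zmultiples z
  R := WindingRel z
  cyc := isCyclicOrder_windingRel hz hcof

lemma CycOrdAbGroup.cDivisible_ofWinding {L : Type u} [AddCommGroup L] [LinearOrder L]
    [IsOrderedAddMonoid L] [Module ℚ L] {z : L} (hz : 0 < z)
    (hcof : ∀ l : L, ∃ n : ℕ, l ≤ n • z) : (ofWinding hz hcof).CDivisible := by
  have hdiv (n : ℕ) (hn : 1 ≤ n) (l : L) : n • ((n : ℚ)⁻¹ • l) = l := by
    rw [← Nat.cast_smul_eq_nsmul ℚ, smul_inv_smul₀ (by positivity)]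
  refine ⟨fun n hn x ↦ ?_, QuotientAddGroup.mk' (AddSubgroup.zmultiples z) (((2 : ℕ) : ℚ)⁻¹ • z),
    ?_, ?_⟩
  · obtain ⟨l, rfl⟩ := QuotientAddGroup.mk'_surjective (AddSubgroup.zmultiples z) x
    exact ⟨QuotientAddGroup.mk' (AddSubgroup.zmultiples z) ((n : ℚ)⁻¹ • l),
      (map_nsmul _ _ _).symm.trans (congrArg _ (hdiv n hn l))⟩
  · intro h
    obtain ⟨n, hn⟩ := AddSubgroup.mem_zmultiples_iff.1 ((QuotientAddGroup.eq_zero_iff _).1 h)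
    have h2 := hdiv 2 one_le_two z
    rw [← hn, ← natCast_zsmul, smul_smul] at h2
    have := zsmul_left_strictMono hz |>.injective (h2.trans (one_zsmul z).symm)
    omega
  · refine isOfFinAddOrder_iff_nsmul_eq_zero.2 ⟨2, two_pos, ?_⟩
    refine (map_nsmul _ _ _).symm.trans ((congrArg _ (hdiv 2 one_le_two z)).trans ?_)
    exact (QuotientAddGroup.eq_zero_iff z).2 (AddSubgroup.mem_zmultiples z)

namespace Unwinding

variable {G : Type*} [AddCommGroup G] {R : G → G → G → Prop} {h : IsCyclicOrder R}
  {L : Type*} [AddCommGroup L] [LinearOrder L] {z : L}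

/-- The homomorphism of wound groups induced by a homomorphism of their unwindings. -/
noncomputable def descend (ι : Unwinding h →+ L) (hz : ι (turns h 1) = z) :
    G →+ L ⧸ AddSubgroup.zmultiples z where
  toFun a := (ι ⟨0, a⟩ : L)
  map_zero' := congrArg _ (map_zero ι)
  map_add' a b := by
    rw [← QuotientAddGroup.mk_add, ← map_add, mk_add_mk, map_add, map_zsmul, hz]
    exact coe_eq_coe_iff_exists_zsmul.2 ⟨carry R a b, add_comm _ _⟩

lemma descend_injective (ι : Unwinding h →+ L) (hz : ι (turns h 1) = z) (hι : StrictMono ι) :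
    Function.Injective (descend ι hz) := by
  refine (injective_iff_map_eq_zero _).2 fun a ha ↦ ?_
  obtain ⟨n, hn⟩ := AddSubgroup.mem_zmultiples_iff.1 ((QuotientAddGroup.eq_zero_iff _).1 ha)
  rw [← hz, ← map_zsmul, ← turns_eq_zsmul] at hn
  exact (congrArg (fun x ↦ x.point) (hι.injective hn)).symm

lemma rel_iff_windingRel_descend (ι : Unwinding h →+ L) (hz : ι (turns h 1) = z)
    (hι : StrictMono ι) (hcyc : IsCyclicOrder (WindingRel z)) (a b c : G) :
    R a b c ↔ WindingRel z (descend ι hz a) (descend ι hz b) (descend ι hz c) := by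
  have base {b c : G} (hbc : R 0 b c) :
      WindingRel z (descend ι hz 0) (descend ι hz b) (descend ι hz c) := by
    refine ⟨ι ⟨0, 0⟩, ι ⟨0, b⟩, ι ⟨0, c⟩, rfl, rfl, rfl, ?_, ?_, ?_⟩
    · exact hι (mk_pos (h.1 _ _ _ hbc).1.symm)
    · exact hι (mk_lt_mk hbc)
    · rw [← hz, ← map_add]
      refine hι ((mk_lt_turns c).trans_eq (zero_add _).symm)
  have forward {a b c : G} (habc : R a b c) :
      WindingRel z (descend ι hz a) (descend ι hz b) (descend ι hz c) := by
    have := base (b := b - a) (c := c - a) (by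
      simpa [sub_eq_add_neg] using h.2.2.2.2 _ _ _ (-a) habc)
    simpa [← map_add] using hcyc.2.2.2.2 _ _ _ (descend ι hz a) this
  refine ⟨forward, fun H ↦ ?_⟩
  obtain ⟨hab, hbc, hca⟩ := hcyc.1 _ _ _ H
  refine (h.2.2.2.1 a b c (ne_of_apply_ne _ hab) (ne_of_apply_ne _ hbc)
    (ne_of_apply_ne _ hca)).resolve_right fun H' ↦ hcyc.not_swap H (forward H')

end Unwinding

/-- the class of c-divisible cyclically ordered abelian groups has the amalgamation
property. -/
theorem cDivisible_amalgamation
    (G G₁ G₂ : CycOrdAbGroup.{u})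
    (hG : G.CDivisible) (hG₁ : G₁.CDivisible) (hG₂ : G₂.CDivisible)
    (φ₁ : G.carrier →+ G₁.carrier) (hφ₁inj : Function.Injective φ₁)
    (hφ₁ : ∀ a b c : G.carrier, G.R a b c ↔ G₁.R (φ₁ a) (φ₁ b) (φ₁ c))
    (φ₂ : G.carrier →+ G₂.carrier) (hφ₂inj : Function.Injective φ₂)
    (hφ₂ : ∀ a b c : G.carrier, G.R a b c ↔ G₂.R (φ₂ a) (φ₂ b) (φ₂ c)) :
    ∃ (H : CycOrdAbGroup.{u}) (ψ₁ : G₁.carrier →+ H.carrier) (ψ₂ : G₂.carrier →+ H.carrier),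
      H.CDivisible ∧
      Function.Injective ψ₁ ∧
      (∀ a b c : G₁.carrier, G₁.R a b c ↔ H.R (ψ₁ a) (ψ₁ b) (ψ₁ c)) ∧
      Function.Injective ψ₂ ∧
      (∀ a b c : G₂.carrier, G₂.R a b c ↔ H.R (ψ₂ a) (ψ₂ b) (ψ₂ c)) ∧
      ψ₁.comp φ₁ = ψ₂.comp φ₂ := by
  let κ₁ := Unwinding.map G₁.cyc G.cyc φ₁ hφ₁inj hφ₁
  let κ₂ := Unwinding.map G₂.cyc G.cyc φ₂ hφ₂inj hφ₂
  obtain ⟨L, _, _, _, ι₁, ι₂, hι₁, hι₂, hcomp, hgen⟩ := exists_orderedAmalgam κ₁ κ₂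
    (Unwinding.map_strictMono _ _ hφ₁inj hφ₁) (Unwinding.map_strictMono _ _ hφ₂inj hφ₂)
  have hι : ∀ k, ι₁ (κ₁ k) = ι₂ (κ₂ k) := DFunLike.congr_fun hcomp
  let z₁ := Unwinding.turns G₁.cyc 1
  let z₂ := Unwinding.turns G₂.cyc 1
  have hκ₁ : κ₁ (Unwinding.turns G.cyc 1) = z₁ := Unwinding.ext rfl (map_zero φ₁)
  have hκ₂ : κ₂ (Unwinding.turns G.cyc 1) = z₂ := Unwinding.ext rfl (map_zero φ₂)
  have hz : ι₂ z₂ = ι₁ z₁ := by rw [← hκ₁, ← hκ₂, hι]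
  have hcofL : ∀ l : L, ∃ n : ℕ, l ≤ n • ι₁ z₁ := fun l ↦ by
    obtain ⟨a, b, rfl⟩ := hgen l
    obtain ⟨n, hn⟩ := Unwinding.exists_le_nsmul a
    obtain ⟨m, hm⟩ := Unwinding.exists_le_nsmul b
    refine ⟨n + m, ?_⟩
    rw [add_smul]
    refine add_le_add ?_ ?_
    · simpa using hι₁.monotone hn
    · simpa [← hz] using hι₂.monotone hm
  let δ := DivisibleHull.coeAddMonoidHom L
  have hδ : StrictMono δ := fun a b hab ↦ by simpa [δ] using hab
  have hz0 : 0 < δ (ι₁ z₁) := by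
    simpa using hδ (hι₁ (Unwinding.turns_pos (h := G₁.cyc)))
  have hcof : ∀ l : DivisibleHull L, ∃ n : ℕ, l ≤ n • δ (ι₁ z₁) := fun l ↦ by
    induction l with | mk m s
    obtain ⟨n, hn⟩ := hcofL |m|
    refine ⟨n, le_trans ?_ ((hδ.monotone hn).trans_eq (map_nsmul δ _ _))⟩
    change _ ≤ DivisibleHull.mk |m| 1
    rw [DivisibleHull.mk_le_mk, PNat.one_coe, one_smul]
    exact (le_abs_self m).trans (le_self_nsmul (abs_nonneg m) s.ne_zero)
  have hz₂ : (δ.comp ι₂) z₂ = δ (ι₁ z₁) := congrArg δ hz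
  have hcyc := isCyclicOrder_windingRel hz0 hcof
  refine ⟨.ofWinding hz0 hcof, Unwinding.descend (δ.comp ι₁) rfl,
    Unwinding.descend (δ.comp ι₂) hz₂, CycOrdAbGroup.cDivisible_ofWinding hz0 hcof,
    Unwinding.descend_injective _ _ (hδ.comp hι₁),
    Unwinding.rel_iff_windingRel_descend _ _ (hδ.comp hι₁) hcyc,
    Unwinding.descend_injective _ _ (hδ.comp hι₂),
    Unwinding.rel_iff_windingRel_descend _ _ (hδ.comp hι₂) hcyc, ?_⟩
  ext g
  exact congrArg (fun l ↦ (δ l : DivisibleHull L ⧸ AddSubgroup.zmultiples (δ (ι₁ z₁)))) (hι ⟨0, g⟩)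
end

section
/- Let Γ be a divisible abelian group which contains an element of infinite order and whose torsion subgroup is isomorphic, as an abstract group, to ℚ/ℤ. Then Γ admits an uncountable family of cyclic orders that are pairwise non-c-isomorphic: there exist an uncountable index set I and cyclic orders (R_i)_{i∈I} on Γ such that for all i ≠ j there is no group automorphism φ of Γ with R_i(a,b,c) ↔ R_j(φ(a),φ(b),φ(c)) for all a,b,c. -/
/-- The cyclic order obtained by pulling back, along `s`, the cyclic order underlying a linear
order. -/
def cyclicPullback {G U : Type*} [LT U] (s : G → U) (a b c : G) : Prop :=
  (s a < s b ∧ s b < s c) ∨ (s b < s c ∧ s c < s a) ∨ (s c < s a ∧ s a < s b)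

/-- `s` maps `G` injectively into the fundamental domain `[0, u)` of `U`, and is additive
modulo `u`. -/
structure IsFundamentalLift {G U : Type*} [AddCommGroup G] [AddCommGroup U] [LinearOrder U]
    (u : U) (s : G → U) : Prop where
  injective : Function.Injective s
  nonneg : ∀ a, 0 ≤ s a
  lt : ∀ a, s a < u
  map_add : ∀ a b, s (a + b) = s a + s b ∨ s (a + b) = s a + s b - u

namespace IsFundamentalLift

variable {G U : Type*} [AddCommGroup G] [AddCommGroup U] [LinearOrder U]
  {u : U} {s : G → U}

theorem map_zero (h : IsFundamentalLift u s) : s 0 = 0 := by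
  rcases h.map_add 0 0 with h0 | h0
  · simpa using h0
  · have h1 := h.lt 0
    rw [add_zero] at h0
    have : s 0 = u := by
      have := sub_eq_zero.mpr h0
      rw [← sub_eq_zero, ← neg_eq_zero, ← this]
      abel
    exact absurd h1 this.not_lt

theorem cyclicPullback_zero_iff (h : IsFundamentalLift u s) {a b : G} (ha : a ≠ 0) :
    cyclicPullback s 0 a b ↔ s a < s b := by
  have hpos : 0 < s a :=
    lt_of_le_of_ne (h.nonneg a) fun h0 ↦ ha (h.injective (by rw [← h0, h.map_zero]))
  have hb := (h.nonneg b).not_gt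
  simp only [cyclicPullback, h.map_zero]
  have := hpos.not_gt
  tauto

theorem zero_lt_iff (h : IsFundamentalLift u s) {b : G} : s 0 < s b ↔ b ≠ 0 := by
  rw [h.map_zero, lt_iff_le_and_ne, ← h.map_zero]
  constructor
  · rintro h1 rfl
    exact h1.2 rfl
  · exact fun hb ↦ ⟨h.map_zero ▸ h.nonneg b, fun h0 ↦ hb (h.injective h0.symm)⟩

theorem comp_addEquiv (h : IsFundamentalLift u s) {H : Type*} [AddCommGroup H] (φ : H ≃+ G) :
    IsFundamentalLift u (s ∘ φ) where
  injective := h.injective.comp φ.injective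
  nonneg a := h.nonneg _
  lt a := h.lt _
  map_add a b := by simpa using h.map_add (φ a) (φ b)

theorem lt_iff_lt {t : G → U} (hs : IsFundamentalLift u s) (ht : IsFundamentalLift u t)
    (h : ∀ a b c, cyclicPullback s a b c ↔ cyclicPullback t a b c) (a b : G) :
    s a < s b ↔ t a < t b := by
  rcases eq_or_ne a 0 with rfl | ha
  · rw [hs.zero_lt_iff, ht.zero_lt_iff]
  · rw [← hs.cyclicPullback_zero_iff ha, ← ht.cyclicPullback_zero_iff ha, h]

variable [IsOrderedAddMonoid U]

theorem map_add_of_lt (h : IsFundamentalLift u s) {a b : G} (hab : s (a + b) < s a) :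
    s (a + b) = s a + s b - u := by
  refine (h.map_add a b).resolve_left fun h0 ↦ ?_
  rw [h0] at hab
  exact hab.not_ge (le_add_of_nonneg_right (h.nonneg b))

theorem map_add_of_not_lt (h : IsFundamentalLift u s) {a b : G} (hab : ¬ s (a + b) < s a) :
    s (a + b) = s a + s b := by
  refine (h.map_add a b).resolve_right fun h0 ↦ hab ?_
  rw [h0, add_sub_assoc]
  exact add_lt_of_neg_right _ (sub_neg.mpr (h.lt b))

theorem lt_translate (h : IsFundamentalLift u s) {a b : G} (x : G) (hab : s a < s b) :
    (s (a + x) < s (b + x) ∧ s x ≤ s (a + x) ∧ s x ≤ s (b + x)) ∨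
    (s (a + x) < s (b + x) ∧ s (a + x) < s x ∧ s (b + x) < s x) ∨
    (s (b + x) < s x ∧ s x ≤ s (a + x)) := by
  have low : ∀ c, s (c + x) = s c + s x → s x ≤ s (c + x) := fun c hc ↦
    hc ▸ le_add_of_nonneg_left (h.nonneg c)
  have high : ∀ c, s (c + x) = s c + s x - u → s (c + x) < s x := fun c hc ↦ by
    rw [hc, add_comm, add_sub_assoc]
    exact add_lt_of_neg_right _ (sub_neg.mpr (h.lt c))
  rcases h.map_add a x with ha | ha <;> rcases h.map_add b x with hb | hb
  · exact Or.inl ⟨by rw [ha, hb]; gcongr, low _ ha, low _ hb⟩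
  · exact Or.inr (Or.inr ⟨high _ hb, low _ ha⟩)
  · have h1 : s a + s x < u :=
      (add_lt_add_left hab (s x)).trans (hb ▸ h.lt (b + x))
    exact absurd (h.nonneg (a + x)) (not_le.mpr (ha ▸ sub_neg.mpr h1))
  · exact Or.inr (Or.inl ⟨by rw [ha, hb]; gcongr, high _ ha, high _ hb⟩)

theorem isCyclicOrder (h : IsFundamentalLift u s) : IsCyclicOrder (cyclicPullback s) := by
  refine ⟨fun a b c habc ↦ ?_, fun a b c habc ↦ ?_, fun a b c d h1 h2 ↦ ?_,
    fun a b c hab hbc hca ↦ ?_, fun a b c x habc ↦ ?_⟩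
  · simp only [cyclicPullback] at habc
    refine ⟨?_, ?_, ?_⟩ <;> rintro rfl <;> grind
  · simp only [cyclicPullback] at habc ⊢
    tauto
  · simp only [cyclicPullback] at h1 h2 ⊢
    grind
  · have h1 := h.injective.ne hab
    have h2 := h.injective.ne hbc
    have h3 := h.injective.ne hca
    simp only [cyclicPullback]
    grind
  · have key : ∀ {a b c : G}, s a < s b → s b < s c →
        cyclicPullback s (a + x) (b + x) (c + x) := fun {a b c} h1 h2 ↦ by
      have h3 := h.lt_translate x h1
      have h4 := h.lt_translate x h2
      simp only [cyclicPullback]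
      grind
    rcases habc with ⟨h1, h2⟩ | ⟨h1, h2⟩ | ⟨h1, h2⟩
    · exact key h1 h2
    · have := key h1 h2
      simp only [cyclicPullback] at this ⊢
      tauto
    · have := key h1 h2
      simp only [cyclicPullback] at this ⊢
      tauto

end IsFundamentalLift

/-- A bounded additive map to `ℝ` vanishes. -/
theorem AddMonoidHom.eq_zero_of_abs_le {G : Type*} [AddCommGroup G] (f : G →+ ℝ) (C : ℝ)
    (hf : ∀ g, |f g| ≤ C) (g : G) : f g = 0 := by
  by_contra hg
  obtain ⟨n, hn⟩ := exists_lt_nsmul (abs_pos.mpr hg) C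
  have := hf (n • g)
  rw [map_nsmul, abs_nsmul] at this
  exact absurd hn this.not_gt

/-- The real coordinate of a fundamental lift is determined by the cyclic order. -/
theorem IsFundamentalLift.fst_eq {G L : Type*} [AddCommGroup G] [AddCommGroup L] [LinearOrder L]
    [IsOrderedAddMonoid L] {s t : G → ℝ ×ₗ L}
    (hs : IsFundamentalLift (toLex (1, 0)) s) (ht : IsFundamentalLift (toLex (1, 0)) t)
    (h : ∀ a b c, cyclicPullback s a b c ↔ cyclicPullback t a b c) (a : G) :
    (ofLex (s a)).1 = (ofLex (t a)).1 := by
  let f : G →+ ℝ := AddMonoidHom.mk' (fun a ↦ (ofLex (s a)).1 - (ofLex (t a)).1) fun a b ↦ by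
    by_cases hab : s (a + b) < s a
    · rw [hs.map_add_of_lt hab, ht.map_add_of_lt ((hs.lt_iff_lt ht h _ _).mp hab)]
      simp
      ring
    · rw [hs.map_add_of_not_lt hab, ht.map_add_of_not_lt (mt (hs.lt_iff_lt ht h _ _).mpr hab)]
      simp
      ring
  have bound : ∀ {r : G → ℝ ×ₗ L}, IsFundamentalLift (toLex (1, 0)) r → ∀ a,
      0 ≤ (ofLex (r a)).1 ∧ (ofLex (r a)).1 ≤ 1 := fun hr a ↦
    ⟨Prod.Lex.monotone_fst _ _ (hr.nonneg a), Prod.Lex.monotone_fst _ _ (hr.lt a).le⟩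
  refine sub_eq_zero.mp (f.eq_zero_of_abs_le 1 (fun g ↦ ?_) a)
  have h1 := bound hs g
  have h2 := bound ht g
  change |(ofLex (s g)).1 - (ofLex (t g)).1| ≤ 1
  rw [abs_le]
  constructor <;> linarith [h1.1, h1.2, h2.1, h2.2]

/-- A pair of homomorphisms to the circle and to an ordered group that are jointly injective
yields a fundamental lift. -/
theorem exists_isFundamentalLift {G L : Type*} [AddCommGroup G] [AddCommGroup L] [LinearOrder L]
    [IsOrderedAddMonoid L] (χ : G →+ UnitAddCircle) (π : G →+ L)
    (hinj : ∀ a, χ a = 0 → π a = 0 → a = 0) :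
    ∃ s : G → ℝ ×ₗ L, IsFundamentalLift (toLex (1, 0)) s ∧
      ∀ a, ((ofLex (s a)).1 : UnitAddCircle) = χ a := by
  have hex : ∀ a, ∃ r : ℝ, 0 ≤ toLex (r, π a) ∧ toLex (r, π a) < toLex (1, (0 : L)) ∧
      (r : UnitAddCircle) = χ a := fun a ↦ by
    have : Fact ((0 : ℝ) < 1) := ⟨one_pos⟩
    obtain ⟨r, ⟨h0, h1⟩, hr⟩ := (AddCircle.coe_image_Ico_eq (1 : ℝ) 0).symm ▸ Set.mem_univ (χ a)
    rw [zero_add] at h1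
    rcases h0.lt_or_eq with h0 | rfl
    · exact ⟨r, Prod.Lex.toLex_le_toLex.mpr (Or.inl h0),
        Prod.Lex.toLex_lt_toLex.mpr (Or.inl h1), hr⟩
    · rcases le_or_gt 0 (π a) with hπ | hπ
      · exact ⟨0, Prod.Lex.toLex_le_toLex.mpr (Or.inr ⟨rfl, hπ⟩),
          Prod.Lex.toLex_lt_toLex.mpr (Or.inl one_pos), hr⟩
      · exact ⟨1, Prod.Lex.toLex_le_toLex.mpr (Or.inl one_pos),
          Prod.Lex.toLex_lt_toLex.mpr (Or.inr ⟨rfl, hπ⟩), by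
          rw [← hr, AddCircle.coe_period, AddCircle.coe_zero]⟩
  choose r h0 h1 hr using hex
  refine ⟨fun a ↦ toLex (r a, π a), ⟨fun a b hab ↦ ?_, h0, h1, fun a b ↦ ?_⟩, hr⟩
  · have h2 : (r a, π a) = (r b, π b) := toLex.injective hab
    rw [Prod.mk.injEq] at h2
    rw [← sub_eq_zero]
    apply hinj
    · rw [map_sub, ← hr, ← hr, h2.1, sub_self]
    · rw [map_sub, h2.2, sub_self]
  · obtain ⟨n, hn⟩ : ∃ n : ℤ, (n : ℝ) = r a + r b - r (a + b) := by
      have : ((r a + r b - r (a + b) : ℝ) : UnitAddCircle) = 0 := by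
        rw [AddCircle.coe_sub, AddCircle.coe_add, hr, hr, hr, map_add, sub_self]
      obtain ⟨n, hn⟩ := (AddCircle.coe_eq_zero_iff (1 : ℝ)).mp this
      exact ⟨n, by simpa using hn⟩
    have hsum : toLex (r a, π a) + toLex (r b, π b) - toLex (r (a + b), π (a + b)) =
        toLex ((n : ℝ), (0 : L)) := by
      rw [hn, ← toLex_add, ← toLex_sub]
      simp
    have hn0 : -1 < n := by
      have h2 : -toLex ((1 : ℝ), (0 : L)) < toLex ((n : ℝ), (0 : L)) := by
        rw [← hsum]
        exact (neg_lt_neg (h1 (a + b))).trans_le (by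
          rw [sub_eq_add_neg]
          exact le_add_of_nonneg_left (add_nonneg (h0 a) (h0 b)))
      rw [← toLex_neg, Prod.Lex.toLex_lt_toLex] at h2
      simp at h2
      exact_mod_cast h2
    have hn1 : n < 2 := by
      have h2 : toLex ((n : ℝ), (0 : L)) < toLex ((1 : ℝ), (0 : L)) + toLex ((1 : ℝ), (0 : L)) := by
        rw [← hsum]
        exact (sub_le_self _ (h0 _)).trans_lt (add_lt_add (h1 a) (h1 b))
      rw [← toLex_add, Prod.Lex.toLex_lt_toLex] at h2
      norm_num at h2
      exact_mod_cast h2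
    obtain rfl | rfl : n = 0 ∨ n = 1 := by omega
    · left
      rw [Int.cast_zero] at hsum
      exact (sub_eq_zero.mp hsum).symm
    · right
      rw [Int.cast_one] at hsum
      rw [← hsum, sub_sub_cancel]

/-- Every abelian group maps to a linearly ordered abelian group with only torsion elements in the
kernel. -/
theorem exists_hom_to_ordered_ker_torsion.{u} (G : Type u) [AddCommGroup G] :
    ∃ (ι : Type u) (_ : LinearOrder ι) (π : G →+ Lex (ι →₀ ℚ)),
      ∀ a, π a = 0 → IsOfFinAddOrder a := by
  let b := Module.Basis.ofVectorSpace ℚ (DivisibleHull G)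
  obtain ⟨hlin, -⟩ := exists_wellFoundedLT (Module.Basis.ofVectorSpaceIndex ℚ (DivisibleHull G))
  refine ⟨Module.Basis.ofVectorSpaceIndex ℚ (DivisibleHull G), hlin, AddMonoidHom.mk' (fun a ↦ toLex (b.repr (a : DivisibleHull G)))
    fun x y ↦ ?_, fun a ha ↦ ?_⟩
  · rw [DivisibleHull.coe_add, map_add, toLex_add]
  · have h1 : b.repr (a : DivisibleHull G) = 0 := ha
    rw [LinearEquiv.map_eq_zero_iff, ← DivisibleHull.mk_zero 1] at h1
    obtain ⟨u, hu⟩ := DivisibleHull.mk_eq_mk.mp h1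
    exact isOfFinAddOrder_iff_nsmul_eq_zero.mpr ⟨u, u.pos, by simpa using hu⟩

/-- If the torsion subgroup is `ℚ/ℤ` and there is an element of infinite order, then every point of
the circle lies in the countable image of a homomorphism that is injective on torsion. -/
theorem exists_hom_unitAddCircle {G : Type*} [AddCommGroup G]
    (hinf : ∃ g : G, ¬ IsOfFinAddOrder g)
    (htor : Nonempty ((AddCommGroup.torsion G) ≃+ (ℚ ⧸ AddSubgroup.zmultiples (1 : ℚ))))
    (x : UnitAddCircle) :
    ∃ χ : G →+ UnitAddCircle, (∀ a, IsOfFinAddOrder a → χ a = 0 → a = 0) ∧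
      (Set.range χ).Countable ∧ x ∈ Set.range χ := by
  obtain ⟨g, hg⟩ := hinf
  obtain ⟨e⟩ := htor
  obtain ⟨τ, hτ⟩ := (Module.Baer.of_divisible (AddCircle (1 : ℚ))).extension_property_addMonoidHom
    (AddCommGroup.torsion G).subtype Subtype.val_injective e.toAddMonoidHom
  obtain ⟨ρ, hρ⟩ := (Module.Baer.of_divisible ℚ).extension_property_addMonoidHom
    (zmultiplesHom G g) (injective_zsmul_iff_not_isOfFinAddOrder.mpr hg) (zmultiplesHom ℚ 1)
  let ι : AddCircle (1 : ℚ) →+ UnitAddCircle :=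
    QuotientAddGroup.map _ _ (Rat.castHom ℝ).toAddMonoidHom (by
      rw [AddSubgroup.zmultiples_le]
      exact ⟨1, by simp⟩)
  have hι : Function.Injective ι := by
    rw [injective_iff_map_eq_zero]
    intro y hy
    induction y using QuotientAddGroup.induction_on with
    | H q =>
      have h1 : ((q : ℝ) : UnitAddCircle) = 0 := hy
      obtain ⟨n, hn⟩ := (AddCircle.coe_eq_zero_iff (1 : ℝ)).mp h1
      refine (AddCircle.coe_eq_zero_iff (1 : ℚ)).mpr ⟨n, ?_⟩
      simp only [zsmul_eq_mul, mul_one] at hn ⊢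
      exact_mod_cast hn
  obtain ⟨α, hα⟩ := QuotientAddGroup.mk_surjective (x - ι (τ g))
  let m : ℚ →+ UnitAddCircle := (QuotientAddGroup.mk' (AddSubgroup.zmultiples (1 : ℝ))).comp
    ((AddMonoidHom.mulRight α).comp (Rat.castHom ℝ).toAddMonoidHom)
  refine ⟨ι.comp τ + m.comp ρ, fun a ha h0 ↦ ?_, ?_, g, ?_⟩
  · have hρa : ρ a = 0 := by
      exact (isOfFinAddOrder_iff_eq_zero _).mp (ρ.isOfFinAddOrder ha)
    have h1 : τ a = e ⟨a, ha⟩ := DFunLike.congr_fun hτ ⟨a, ha⟩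
    simp only [AddMonoidHom.add_apply, AddMonoidHom.comp_apply, hρa, map_zero, add_zero] at h0
    rw [map_eq_zero_iff ι hι, h1, map_eq_zero_iff e e.injective] at h0
    exact congrArg Subtype.val h0
  · have : Countable (AddCircle (1 : ℚ)) := QuotientAddGroup.mk_surjective.countable
    refine (Set.countable_range fun p : AddCircle (1 : ℚ) × ℚ ↦ ι p.1 + m p.2).mono ?_
    rintro _ ⟨a, rfl⟩
    exact ⟨(τ a, ρ a), rfl⟩
  · have h1 : ρ g = 1 := by simpa using DFunLike.congr_fun hρ 1
    have h2 : m 1 = x - ι (τ g) := by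
      rw [← hα]
      simp [m]
    simp [h1, h2]


/-- If `Γ` is a divisible abelian group containing an element of infinite order
and whose torsion subgroup is isomorphic to `ℚ/ℤ`, then `Γ` carries an uncountable family of
pairwise non-c-isomorphic cyclic orders. -/
theorem uncountably_many_non_cIso_cyclic_orders
    {Γ : Type*} [AddCommGroup Γ]
    (hdiv : ∀ n : ℕ, 1 ≤ n → ∀ a : Γ, ∃ b : Γ, n • b = a)
    (hinf : ∃ g : Γ, ¬ IsOfFinAddOrder g)
    (htor : Nonempty ((AddCommGroup.torsion Γ) ≃+ (ℚ ⧸ AddSubgroup.zmultiples (1 : ℚ)))) :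
    ∃ (I : Type) (_ : Uncountable I) (Rfam : I → (Γ → Γ → Γ → Prop)),
      (∀ i, IsCyclicOrder (Rfam i)) ∧
      ∀ i j, i ≠ j →
        ¬ ∃ φ : Γ ≃+ Γ, ∀ a b c : Γ, Rfam i a b c ↔ Rfam j (φ a) (φ b) (φ c) := by
  let I : Type := {S : Set UnitAddCircle // S.Countable ∧
    ∃ χ : Γ →+ UnitAddCircle, (∀ a, IsOfFinAddOrder a → χ a = 0 → a = 0) ∧ Set.range χ = S}
  have hI : Uncountable I := by
    by_contra hcount
    rw [not_uncountable_iff] at hcount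
    have hcover : (Set.univ : Set UnitAddCircle) = ⋃ S : I, S.1 := by
      refine (Set.eq_univ_of_forall fun x ↦ ?_).symm
      obtain ⟨χ, hχ, hc, hx⟩ := exists_hom_unitAddCircle hinf htor x
      exact Set.mem_iUnion.mpr ⟨⟨_, hc, χ, hχ, rfl⟩, hx⟩
    have h1 : (Set.univ : Set UnitAddCircle).Countable :=
      hcover ▸ Set.countable_iUnion fun S ↦ S.2.1
    have h2 : Countable (Set.Ico (0 : ℝ) (0 + 1)) :=
      have : Fact ((0 : ℝ) < 1) := ⟨one_pos⟩
      have := Set.countable_univ_iff.mp h1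
      (AddCircle.equivIco (1 : ℝ) 0).symm.injective.countable
    have h3 := Cardinal.Real.Ico_countable_iff.mp (Set.countable_coe_iff.mp h2)
    norm_num at h3
  obtain ⟨ι, _, π, hπ⟩ := exists_hom_to_ordered_ker_torsion Γ
  choose χ hχ hrange using fun S : I ↦ S.2.2
  choose s hs hsχ using fun S : I ↦
    exists_isFundamentalLift (χ S) π fun a h0 h1 ↦ hχ S a (hπ a h1) h0
  refine ⟨I, hI, fun S ↦ cyclicPullback (s S), fun S ↦ (hs S).isCyclicOrder, ?_⟩
  rintro S T hST ⟨φ, hφ⟩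
  have key : ∀ a, χ S a = χ T (φ a) := fun a ↦ by
    rw [← hsχ, ← hsχ, (hs S).fst_eq ((hs T).comp_addEquiv φ) hφ a]
    rfl
  refine hST (Subtype.ext ?_)
  rw [← hrange S, ← hrange T, ← φ.surjective.range_comp (χ T)]
  exact congrArg Set.range (funext key)
end

section
/- There exists a family, indexed by a set of cardinality 2^{ℵ₀} (the continuum), of cyclic orders on the additive group ℚ of rational numbers that are pairwise non-c-isomorphic: for any two distinct indices i,j there is no additive group automorphism φ of ℚ such that R_i(a,b,c) ↔ R_j(φ(a),φ(b),φ(c)) for all a,b,c. -/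
/-- The cyclic order on `ℚ` pulled back from the circle `ℝ / ℤ` along `q ↦ r * q`. -/
def rotationOrder (r : ℝ) (a b c : ℚ) : Prop :=
  0 < Int.fract (r * (b - a : ℚ)) ∧ Int.fract (r * (b - a : ℚ)) < Int.fract (r * (c - a : ℚ))

lemma fract_sub_eq_sub_fract_of_le {x y : ℝ} (h : Int.fract x ≤ Int.fract y) :
    Int.fract (y - x) = Int.fract y - Int.fract x := by
  rw [Int.fract_eq_iff]
  refine ⟨by linarith, by linarith [Int.fract_lt_one y, Int.fract_nonneg x], ⌊y⌋ - ⌊x⌋, ?_⟩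
  push_cast
  linarith [Int.floor_add_fract x, Int.floor_add_fract y]

lemma fract_mul_rat_injective {r : ℝ} (hr : Irrational r) :
    Function.Injective fun q : ℚ => Int.fract (r * q) := by
  intro p q h
  obtain ⟨z, hz⟩ := Int.fract_eq_fract.1 h
  by_contra hpq
  have hne : p - q ≠ 0 := sub_ne_zero.2 hpq
  refine (hr.mul_ratCast hne).ne_int z ?_
  push_cast
  linarith

lemma isCyclicOrder_rotationOrder {r : ℝ} (hr : Irrational r) :
    IsCyclicOrder (rotationOrder r) := by
  have inj := fract_mul_rat_injective hr
  have pos : ∀ q : ℚ, q ≠ 0 → 0 < Int.fract (r * q) := fun q hq =>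
    (Int.fract_nonneg _).lt_of_ne fun h => hq (inj (by simpa using h.symm))
  refine ⟨?_, ?_, ?_, ?_, ?_⟩
  · rintro a b c ⟨h0, h1⟩
    refine ⟨?_, ?_, ?_⟩
    · rintro rfl; simp at h0
    · rintro rfl; exact lt_irrefl _ h1
    · rintro rfl; simp at h1; exact absurd h1 (Int.fract_nonneg _).not_gt
  · rintro a b c ⟨h0, h1⟩
    have e1 : r * (c - b : ℚ) = r * (c - a : ℚ) - r * (b - a : ℚ) := by push_cast; ring
    have e2 : r * (a - b : ℚ) = -(r * (b - a : ℚ)) := by push_cast; ring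
    rw [rotationOrder, e1, e2, fract_sub_eq_sub_fract_of_le h1.le, Int.fract_neg h0.ne']
    exact ⟨by linarith, by linarith [Int.fract_lt_one (r * (c - a : ℚ))]⟩
  · rintro a b c d ⟨h0, h1⟩ ⟨-, h2⟩
    exact ⟨h0, h1.trans h2⟩
  · intro a b c hab hbc hca
    have hne : Int.fract (r * (b - a : ℚ)) ≠ Int.fract (r * (c - a : ℚ)) := fun h =>
      hbc (sub_left_injective (inj h))
    exact hne.lt_or_gt.imp (fun h => ⟨pos _ (sub_ne_zero.2 hab.symm), h⟩)
      fun h => ⟨pos _ (sub_ne_zero.2 hca), h⟩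
  · intro a b c x h
    simpa only [rotationOrder, add_sub_add_right_eq_sub] using h

lemma rotationOrder_ne_of_lt {r s : ℝ} (hr : 0 < r) (hrs : r < s) :
    rotationOrder r ≠ rotationOrder s := by
  have hs : 0 < s := hr.trans hrs
  obtain ⟨q, hq1, hq2⟩ := exists_rat_btwn
    (show 1 / (2 * s) < min (1 / (2 * r)) (1 / s) from lt_min
      (one_div_lt_one_div_of_lt (by linarith) (by linarith))
      (one_div_lt_one_div_of_lt hs (by linarith)))
  obtain ⟨hq2, hq3⟩ := lt_min_iff.1 hq2
  rw [div_lt_iff₀ (by linarith)] at hq1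
  rw [lt_div_iff₀ (by linarith)] at hq2 hq3
  have hq : (0 : ℝ) < q := by by_contra! h; nlinarith
  have hrq : 0 < r * q := mul_pos hr hq
  have f1 : Int.fract (r * q) = r * q := Int.fract_eq_self.2 ⟨hrq.le, by linarith⟩
  have f2 : Int.fract (r * (2 * q)) = r * (2 * q) :=
    Int.fract_eq_self.2 ⟨by linarith, by linarith⟩
  have f3 : Int.fract (s * q) = s * q := Int.fract_eq_self.2 ⟨by positivity, by linarith⟩
  have f4 : Int.fract (s * (2 * q)) = s * (2 * q) - 1 :=
    Int.fract_eq_iff.2 ⟨by linarith, by linarith, 1, by push_cast; ring⟩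
  intro h
  have key : rotationOrder r 0 q (2 * q) := by
    simp only [rotationOrder, sub_zero]
    push_cast
    rw [f1, f2]
    exact ⟨hrq, by linarith⟩
  rw [h] at key
  simp only [rotationOrder, sub_zero] at key
  push_cast at key
  rw [f3, f4] at key
  linarith [key.2]

lemma rotationOrder_injOn : Set.InjOn rotationOrder (Set.Ioi 0) := by
  intro r hr s hs h
  by_contra hne
  rcases lt_or_gt_of_ne hne with hlt | hlt
  · exact rotationOrder_ne_of_lt hr hlt h
  · exact rotationOrder_ne_of_lt hs hlt h.symm

instance countable_rat_addEquiv : Countable (ℚ ≃+ ℚ) := by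
  refine Function.Injective.countable (f := fun φ : ℚ ≃+ ℚ => φ 1) fun φ ψ h => ?_
  ext q
  have key : ∀ χ : ℚ ≃+ ℚ, χ q = q * χ 1 := fun χ => by
    simpa using map_rat_smul χ q (1 : ℚ)
  rw [key, key]
  exact congrArg _ h

/-- The relation of being c-isomorphic, on the cyclic orders of `ℚ`. -/
def cIsoSetoid : Setoid {R : ℚ → ℚ → ℚ → Prop // IsCyclicOrder R} where
  r R S := ∃ φ : ℚ ≃+ ℚ, ∀ a b c, R.1 a b c ↔ S.1 (φ a) (φ b) (φ c)
  iseqv := ⟨fun _ => ⟨AddEquiv.refl ℚ, fun _ _ _ => Iff.rfl⟩,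
    fun ⟨φ, h⟩ => ⟨φ.symm, fun a b c => by simp [h]⟩,
    fun ⟨φ, h⟩ ⟨ψ, k⟩ => ⟨φ.trans ψ, fun a b c => by simp [h, k]⟩⟩

open Cardinal in
lemma continuum_le_mk_cyclicOrder :
    𝔠 ≤ #{R : ℚ → ℚ → ℚ → Prop // IsCyclicOrder R} := by
  have hS : 𝔠 ≤ #↥(Set.Ioi (0 : ℝ) \ Set.range ((↑) : ℚ → ℝ)) := by
    by_contra! hlt
    refine (mk_Ioi_real 0).not_lt ((le_mk_sdiff_add_mk _ (Set.range ((↑) : ℚ → ℝ))).trans_lt ?_)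
    exact add_lt_of_lt aleph0_le_continuum hlt
      ((Set.countable_range _).le_aleph0.trans_lt aleph0_lt_continuum)
  refine hS.trans <| mk_le_of_injective
    (f := fun r => ⟨rotationOrder r, isCyclicOrder_rotationOrder r.2.2⟩) fun r s h => ?_
  exact Subtype.ext (rotationOrder_injOn r.2.1 s.2.1 (congrArg Subtype.val h))

open Cardinal in
lemma mk_cIso_quotient : #(Quotient cIsoSetoid) = 𝔠 := by
  apply le_antisymm
  · refine mk_quotient_le.trans ((mk_subtype_le _).trans ?_)
    simp
  · have hle : #{R : ℚ → ℚ → ℚ → Prop // IsCyclicOrder R} ≤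
        #(Quotient cIsoSetoid × (ℚ ≃+ ℚ)) := by
      have h : ∀ R, ∃ φ : ℚ ≃+ ℚ, ∀ a b c,
          R.1 a b c ↔ (Quotient.mk cIsoSetoid R).out.1 (φ a) (φ b) (φ c) := fun R =>
        cIsoSetoid.symm (Quotient.mk_out (s := cIsoSetoid) R)
      choose φ hφ using h
      refine mk_le_of_injective (f := fun R => (Quotient.mk cIsoSetoid R, φ R)) fun R S hRS => ?_
      obtain ⟨h1, h2⟩ := Prod.mk.inj hRS
      ext a b c
      rw [hφ R, hφ S, h1, h2]
    by_contra! hlt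
    have := (continuum_le_mk_cyclicOrder.trans hle).trans_eq (mk_prod _ _)
    rw [lift_id, lift_id] at this
    exact this.not_gt (mul_lt_of_lt aleph0_le_continuum hlt
      (mk_le_aleph0.trans_lt aleph0_lt_continuum))

/-- There is a family of cyclic orders on `(ℚ,+)`, indexed by a set of cardinality
`2 ^ ℵ₀`, that are pairwise non-c-isomorphic. -/
theorem continuum_many_non_cIso_cyclic_orders_on_rat :
    ∃ (I : Type) (Rfam : I → (ℚ → ℚ → ℚ → Prop)),
      Cardinal.mk I = 2 ^ Cardinal.aleph0 ∧
      (∀ i, IsCyclicOrder (Rfam i)) ∧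
      ∀ i j, i ≠ j →
        ¬ ∃ φ : ℚ ≃+ ℚ, ∀ a b c : ℚ, Rfam i a b c ↔ Rfam j (φ a) (φ b) (φ c) := by
  refine ⟨Quotient cIsoSetoid, fun i => i.out.1, ?_, fun i => i.out.2, fun i j hij h => hij ?_⟩
  · rw [mk_cIso_quotient, Cardinal.two_power_aleph0]
  · exact Quotient.out_equiv_out.1 h
end

section
/- Let G be an additive subgroup of (ℝ/ℤ) × ℚ which is isomorphic, as an abstract additive group, to ℚ. Then there exist a real number θ, a rational number a ≥ 0 with the property that a = 0 implies θ is irrational, and a function f from the positive integers to ℕ satisfying (*) and (**), such that G is the subgroup of (ℝ/ℤ) × ℚ generated by the elements ( (θ + f(n))/n mod ℤ , a/n ) for n ranging over the positive integers. -/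
/-- Two reals agree in `ℝ/ℤ` exactly when they differ by an integer. -/
theorem coe_unitCircle_eq_iff_exists_int {x y : ℝ} :
    (x : AddCircle (1 : ℝ)) = (y : AddCircle (1 : ℝ)) ↔ ∃ j : ℤ, x + j = y := by
  rw [eq_comm, ← sub_eq_zero, ← AddCircle.coe_sub, AddCircle.coe_eq_zero_iff]
  refine exists_congr fun j => ?_
  rw [zsmul_eq_mul, mul_one, eq_sub_iff_add_eq, add_comm]

/-- Each `n`-th part of the class of `θ` in `ℝ/ℤ` is the class of `(θ + k) / n` for some
natural number `k < n`. -/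
theorem exists_lt_eq_coe_add_div {n : ℕ} (hn : 0 < n) {θ : ℝ} {z : AddCircle (1 : ℝ)}
    (hz : n • z = (θ : AddCircle (1 : ℝ))) :
    ∃ k : ℕ, k < n ∧ z = (((θ + (k : ℝ)) / (n : ℝ) : ℝ) : AddCircle (1 : ℝ)) := by
  obtain ⟨x, rfl⟩ := QuotientAddGroup.mk_surjective z
  change n • (x : AddCircle (1 : ℝ)) = θ at hz
  have hn' : (n : ℝ) ≠ 0 := by positivity
  have hnz : (n : ℤ) ≠ 0 := by positivity
  rw [← AddCircle.coe_nsmul, eq_comm, coe_unitCircle_eq_iff_exists_int] at hz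
  obtain ⟨j, hj⟩ := hz
  rw [nsmul_eq_mul] at hj
  have hk : ((j % n).toNat : ℤ) = j % n := Int.toNat_of_nonneg (Int.emod_nonneg _ hnz)
  refine ⟨(j % n).toNat, ?_, ?_⟩
  · have := Int.emod_lt_of_pos j (by positivity : (0 : ℤ) < n)
    lia
  · have hd : ((j % n).toNat : ℝ) + n * ((j / n : ℤ) : ℝ) = j := by
      have := Int.emod_add_mul_ediv j n
      rw [← hk] at this
      exact_mod_cast this
    change (x : AddCircle (1 : ℝ)) = _
    rw [eq_comm, coe_unitCircle_eq_iff_exists_int]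
    refine ⟨j / n, ?_⟩
    field_simp
    linarith

/-- If `(θ + k) / n` and `(θ + l) / n` agree in `ℝ/ℤ`, then `k` and `l` agree modulo `n`. -/
theorem modEq_of_coe_add_div_eq {n k l : ℕ} (hn : 0 < n) {θ : ℝ}
    (h : (((θ + (k : ℝ)) / (n : ℝ) : ℝ) : AddCircle (1 : ℝ)) =
      (((θ + (l : ℝ)) / (n : ℝ) : ℝ) : AddCircle (1 : ℝ))) :
    k ≡ l [MOD n] := by
  have hn' : (n : ℝ) ≠ 0 := by positivity
  rw [coe_unitCircle_eq_iff_exists_int] at h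
  obtain ⟨j, hj⟩ := h
  field_simp at hj
  rw [← Int.natCast_modEq_iff, Int.modEq_iff_dvd]
  refine ⟨j, ?_⟩
  have : (l : ℝ) - k = n * j := by linarith
  exact_mod_cast this

/-- A subgroup isomorphic to `ℚ` is the range of an injective homomorphism from `ℚ` which is
nonnegative at `1` in the rational coordinate. -/
theorem exists_injective_range_eq_of_equiv_rat {A : Type*} [AddCommGroup A]
    (G : AddSubgroup (A × ℚ)) (e : G ≃+ ℚ) :
    ∃ h : ℚ →+ A × ℚ, Function.Injective h ∧ h.range = G ∧ 0 ≤ (h 1).2 := by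
  let h : ℚ →+ A × ℚ := G.subtype.comp e.symm.toAddMonoidHom
  have hinj : Function.Injective h := Subtype.val_injective.comp e.symm.injective
  have hrange : h.range = G := by
    ext x
    constructor
    · rintro ⟨q, rfl⟩
      exact (e.symm q).2
    · intro hx
      exact ⟨e ⟨x, hx⟩, by simp [h]⟩
  rcases le_total 0 (h 1).2 with h1 | h1
  · exact ⟨h, hinj, hrange, h1⟩
  · refine ⟨-h, fun x y hxy => hinj (neg_injective hxy), ?_, by simpa using h1⟩
    rw [← hrange]
    ext x
    constructor
    · rintro ⟨q, rfl⟩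
      exact ⟨-q, by simp⟩
    · rintro ⟨q, rfl⟩
      exact ⟨-q, by simp⟩

/-- The range of a homomorphism from `ℚ` is generated by the images of the unit fractions. -/
theorem range_eq_closure_unit_fractions {A : Type*} [AddCommGroup A] (h : ℚ →+ A) :
    h.range = AddSubgroup.closure {x | ∃ n : ℕ, 0 < n ∧ x = h (1 / n)} := by
  apply le_antisymm
  · rintro _ ⟨q, rfl⟩
    have hq : q = q.num • (1 / (q.den : ℚ)) := by
      rw [zsmul_eq_mul, mul_one_div, Rat.num_div_den]
    rw [hq, map_zsmul]
    refine zsmul_mem (AddSubgroup.subset_closure ?_) _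
    exact ⟨q.den, q.den_pos, rfl⟩
  · rw [AddSubgroup.closure_le]
    rintro _ ⟨n, -, rfl⟩
    exact ⟨_, rfl⟩


/-- If `G` is an additive subgroup of `(ℝ/ℤ) × ℚ` which is isomorphic, as an
abstract group, to `ℚ`, then there exist a real `θ`, a rational `a ≥ 0` (with `a = 0` forcing
`θ` to be irrational) and a function `f` on the positive integers satisfying (*) and (**) such
that `G` is generated by the elements `((θ + f n)/n mod ℤ, a/n)` for `n ≥ 1`. -/
theorem subgroup_of_circle_prod_rat_iso_rat
    (G : AddSubgroup (AddCircle (1 : ℝ) × ℚ))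
    (hG : Nonempty (G ≃+ ℚ)) :
    ∃ (θ : ℝ) (a : ℚ), 0 ≤ a ∧ (a = 0 → Irrational θ) ∧
      ∃ f : ℕ → ℕ,
        (∀ n : ℕ, 0 < n → f n ≤ n - 1) ∧
        (∀ m n : ℕ, 0 < m → 0 < n → f n = f (m * n) % n) ∧
        G = AddSubgroup.closure
          {x : AddCircle (1 : ℝ) × ℚ | ∃ n : ℕ, 0 < n ∧
            x = ((((θ + (f n : ℝ)) / (n : ℝ) : ℝ) : AddCircle (1 : ℝ)), a / (n : ℚ))} := by
  obtain ⟨e⟩ := hG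
  obtain ⟨h, hinj, rfl, ha⟩ := exists_injective_range_eq_of_equiv_rat G e
  obtain ⟨θ, hθ⟩ := QuotientAddGroup.mk_surjective (h 1).1
  change (θ : AddCircle (1 : ℝ)) = (h 1).1 at hθ
  have hmul (m n : ℕ) (hm : 0 < m) : m • h (1 / ((m * n : ℕ) : ℚ)) = h (1 / n) := by
    rw [← map_nsmul]
    congr 1
    have : (m : ℚ) ≠ 0 := by positivity
    rw [nsmul_eq_mul, Nat.cast_mul]
    field_simp
  have hone (n : ℕ) (hn : 0 < n) : n • h (1 / n) = h 1 := by
    simpa using hmul n 1 hn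
  have hex (n : ℕ) : ∃ k : ℕ, 0 < n →
      k < n ∧ (h (1 / n)).1 = (((θ + (k : ℝ)) / (n : ℝ) : ℝ) : AddCircle (1 : ℝ)) := by
    rcases Nat.eq_zero_or_pos n with rfl | hn
    · exact ⟨0, fun h => absurd h (lt_irrefl 0)⟩
    · obtain ⟨k, hk⟩ := exists_lt_eq_coe_add_div hn (z := (h (1 / n)).1) (θ := θ)
        (by rw [hθ, ← hone n hn, Prod.smul_fst])
      exact ⟨k, fun _ => hk⟩
  choose f hf using hex
  refine ⟨θ, (h 1).2, ha, ?_, f, fun n hn => Nat.le_sub_one_of_lt (hf n hn).1, ?_, ?_⟩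
  · rintro ha0 ⟨q, rfl⟩
    have hzero : h (q.den : ℚ) = 0 := by
      have hd : (q.den : ℚ) = q.den • (1 : ℚ) := by simp
      rw [hd, map_nsmul]
      ext
      · rw [Prod.smul_fst, ← hθ, ← AddCircle.coe_nsmul, Prod.fst_zero, AddCircle.coe_eq_zero_iff]
        refine ⟨q.num, ?_⟩
        simp only [nsmul_eq_mul, zsmul_eq_mul, mul_one]
        exact_mod_cast (Rat.den_mul_eq_num q).symm
      · simp [ha0]
    have := hinj (hzero.trans (map_zero h).symm)
    exact q.den_nz (by exact_mod_cast this)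
  · intro m n hm hn
    have hm' : (m : ℝ) ≠ 0 := by positivity
    have key : f n ≡ f (m * n) [MOD n] := by
      apply modEq_of_coe_add_div_eq hn (θ := θ)
      rw [← (hf n hn).2, ← hmul m n hm, Prod.smul_fst, (hf (m * n) (by positivity)).2,
        ← AddCircle.coe_nsmul]
      congr 1
      rw [nsmul_eq_mul, Nat.cast_mul]
      field_simp
    rw [← key, Nat.mod_eq_of_lt (hf n hn).1]
  · rw [range_eq_closure_unit_fractions]
    congr 1
    ext x
    refine exists_congr fun n => and_congr_right fun hn => ?_
    have hval : h (1 / n) =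
        ((((θ + (f n : ℝ)) / (n : ℝ) : ℝ) : AddCircle (1 : ℝ)), (h 1).2 / (n : ℚ)) := by
      refine Prod.ext (hf n hn).2 ?_
      have hn' : (n : ℚ) ≠ 0 := by positivity
      rw [eq_div_iff hn', ← hone n hn, Prod.smul_snd, nsmul_eq_mul, mul_comm]
    rw [hval]
end

section
/- Let θ be a real number, a a rational number with a ≥ 0 and such that a = 0 implies θ is irrational, and let f be a function from the positive integers to ℕ satisfying (*) and (**). Then there is an injective additive group homomorphism φ : ℚ → (ℝ/ℤ) × ℚ such that for every m ∈ ℤ and every positive integer n, φ(m/n) = ( m·(θ + f(n))/n mod ℤ , m·a/n ); in particular the set { ( m·(θ + f(n))/n mod ℤ , m·a/n ) : m ∈ ℤ, n a positive integer } is an additive subgroup of (ℝ/ℤ) × ℚ isomorphic to ℚ. -/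
/-- A sequence `c` in an additive commutative group that is compatible under division, in the sense
that `k • c (k * n) = c n`, determines a homomorphism from `ℚ` sending `m / n` to `m • c n`. -/
theorem exists_addMonoidHom_rat_of_nsmul_mul_eq {A : Type*} [AddCommGroup A] (c : ℕ → A)
    (hc : ∀ k n : ℕ, 0 < k → 0 < n → k • c (k * n) = c n) :
    ∃ φ : ℚ →+ A, ∀ (m : ℤ) (n : ℕ), 0 < n → φ ((m : ℚ) / (n : ℚ)) = m • c n := by
  have well_defined : ∀ (m : ℤ) (n : ℕ), 0 < n →
      ((m : ℚ) / (n : ℚ)).num • c ((m : ℚ) / (n : ℚ)).den = m • c n := by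
    intro m n hn
    set q : ℚ := (m : ℚ) / (n : ℚ) with hq
    have hcross : m * (q.den : ℤ) = q.num * (n : ℤ) := by
      have hn' : (n : ℚ) ≠ 0 := by positivity
      have hd : (q.den : ℚ) ≠ 0 := by exact_mod_cast q.den_nz
      have h : (q.num : ℚ) / q.den = m / n := q.num_div_den
      rw [div_eq_div_iff hd hn'] at h
      exact_mod_cast h.symm
    rw [← hc n q.den hn q.den_pos, ← hc q.den n q.den_pos hn, mul_comm n q.den,
      ← natCast_zsmul, ← natCast_zsmul, smul_smul, smul_smul, hcross]
  refine ⟨AddMonoidHom.mk' (fun q => q.num • c q.den) ?_, well_defined⟩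
  intro p q
  have hsum : p + q = ((p.num * q.den + q.num * p.den : ℤ) : ℚ) / ((p.den * q.den : ℕ) : ℚ) := by
    have hp : (p.den : ℚ) ≠ 0 := by exact_mod_cast p.den_nz
    have hq : (q.den : ℚ) ≠ 0 := by exact_mod_cast q.den_nz
    conv_lhs => rw [← p.num_div_den, ← q.num_div_den]
    push_cast
    field_simp
  have hp := hc q.den p.den q.den_pos p.den_pos
  have hq := hc p.den q.den p.den_pos q.den_pos
  rw [mul_comm] at hp
  change (p + q).num • c (p + q).den = p.num • c p.den + q.num • c q.den
  rw [hsum, well_defined _ _ (Nat.mul_pos p.den_pos q.den_pos), add_smul, ← hp, ← hq,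
    ← natCast_zsmul, ← natCast_zsmul, smul_smul, smul_smul, mul_comm p.den q.den]


/-- Given `θ : ℝ`, a rational `a ≥ 0` (irrationality of `θ` required when `a = 0`)
and `f` satisfying (*) and (**), there is an injective additive homomorphism `φ : ℚ →+ (ℝ/ℤ) × ℚ`
with `φ (m/n) = (m·(θ + f n)/n mod ℤ, m·a/n)`; in particular the set of these values is a
subgroup of `(ℝ/ℤ) × ℚ` isomorphic to `ℚ`. -/
theorem exists_embedding_rat_into_circle_prod_rat
    (θ : ℝ) (a : ℚ) (ha : 0 ≤ a) (ha0 : a = 0 → Irrational θ)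
    (f : ℕ → ℕ)
    (hstar : ∀ n : ℕ, 0 < n → f n ≤ n - 1)
    (hstarstar : ∀ m n : ℕ, 0 < m → 0 < n → f n = f (m * n) % n) :
    ∃ φ : ℚ →+ (AddCircle (1 : ℝ) × ℚ),
      Function.Injective φ ∧
      (∀ (m : ℤ) (n : ℕ), 0 < n →
        φ ((m : ℚ) / (n : ℚ)) =
          ((((m : ℝ) * ((θ + (f n : ℝ)) / (n : ℝ)) : ℝ) : AddCircle (1 : ℝ)),
            (m : ℚ) * a / (n : ℚ))) ∧
      Set.range φ = {x : AddCircle (1 : ℝ) × ℚ | ∃ (m : ℤ) (n : ℕ), 0 < n ∧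
        x = ((((m : ℝ) * ((θ + (f n : ℝ)) / (n : ℝ)) : ℝ) : AddCircle (1 : ℝ)),
          (m : ℚ) * a / (n : ℚ))} := by
  have compatible : ∀ k n : ℕ, 0 < k → 0 < n →
      k • ((((θ + f (k * n)) / (k * n : ℕ) : ℝ) : AddCircle (1 : ℝ)), a / (k * n : ℕ)) =
        ((((θ + f n) / n : ℝ) : AddCircle (1 : ℝ)), a / n) := by
    intro k n hk hn
    have hkR : (k : ℝ) ≠ 0 := by positivity
    have hnR : (n : ℝ) ≠ 0 := by positivity
    have hkQ : (k : ℚ) ≠ 0 := by positivity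
    have hnQ : (n : ℚ) ≠ 0 := by positivity
    have hdiv : (f (k * n) : ℝ) = f n + n * (f (k * n) / n : ℕ) := by
      have h := Nat.mod_add_div (f (k * n)) n
      rw [← hstarstar k n hk hn] at h
      exact_mod_cast h.symm
    refine Prod.ext ?_ ?_
    · rw [Prod.smul_fst, ← AddCircle.coe_nsmul, ← sub_eq_zero, ← AddCircle.coe_sub,
        AddCircle.coe_eq_zero_iff]
      refine ⟨(f (k * n) / n : ℕ), ?_⟩
      rw [hdiv]
      simp only [nsmul_eq_mul, zsmul_eq_mul, Nat.cast_mul, Int.cast_natCast]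
      field_simp
      ring
    · rw [Prod.smul_snd, nsmul_eq_mul]
      push_cast
      field_simp
  obtain ⟨φ, hφ⟩ := exists_addMonoidHom_rat_of_nsmul_mul_eq
    (fun n => ((((θ + f n) / n : ℝ) : AddCircle (1 : ℝ)), a / (n : ℚ))) compatible
  have formula : ∀ (m : ℤ) (n : ℕ), 0 < n → φ ((m : ℚ) / (n : ℚ)) =
      ((((m : ℝ) * ((θ + (f n : ℝ)) / (n : ℝ)) : ℝ) : AddCircle (1 : ℝ)),
        (m : ℚ) * a / (n : ℚ)) := by
    intro m n hn
    rw [hφ m n hn, Prod.smul_mk, ← AddCircle.coe_zsmul, zsmul_eq_mul, zsmul_eq_mul, mul_div_assoc]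
  refine ⟨φ, (injective_iff_map_eq_zero φ).2 fun q hq => ?_, formula, ?_⟩
  · rw [← q.num_div_den, formula _ _ q.den_pos, Prod.mk_eq_zero, AddCircle.coe_eq_zero_iff] at hq
    obtain ⟨⟨j, hj⟩, hsnd⟩ := hq
    by_contra hne
    have hnum : q.num ≠ 0 := Rat.num_ne_zero.2 hne
    have ha_zero : a = 0 := by simpa [hnum] using hsnd
    refine ha0 ha_zero ⟨(j : ℚ) * q.den / q.num - f q.den, ?_⟩
    have hnumR : (q.num : ℝ) ≠ 0 := by exact_mod_cast hnum
    have hdenR : (q.den : ℝ) ≠ 0 := by exact_mod_cast q.den_nz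
    rw [zsmul_eq_mul, mul_one] at hj
    push_cast
    rw [hj]
    field_simp
    ring
  · ext x
    constructor
    · rintro ⟨q, rfl⟩
      exact ⟨q.num, q.den, q.den_pos, by rw [← formula _ _ q.den_pos, q.num_div_den]⟩
    · rintro ⟨m, n, hn, rfl⟩
      exact ⟨m / n, formula m n hn⟩
end

section
/- For every family (f_p), indexed by the prime numbers p, of functions f_p from the positive integers to {0,1,…,p−1}, there exists exactly one function f from the positive integers to ℕ satisfying (*) and (**) such that for every prime p and every positive integer r, f(p^r) = f_p(1) + p·f_p(2) + ⋯ + p^{r−1}·f_p(r). Consequently, the functions satisfying (*) and (**) are in one-to-one correspondence with such families (f_p). -/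
/-- Two naturals are congruent modulo `n` once they are so modulo every prime power dividing `n`. -/
theorem Nat.modEq_of_forall_prime_pow {a b n : ℕ}
    (h : ∀ p r : ℕ, p.Prime → p ^ r ∣ n → a ≡ b [MOD p ^ r]) : a ≡ b [MOD n] := by
  rw [Nat.modEq_iff_dvd, Int.natCast_dvd, Nat.dvd_iff_prime_pow_dvd_dvd]
  intro p r hp hr
  exact Int.natCast_dvd.mp (Nat.modEq_iff_dvd.mp (h p r hp hr))

/-- Truncating a base `p` expansion at length `s` does not change it modulo `p ^ s`. -/
theorem Nat.sum_range_pow_mul_modEq (p : ℕ) (c : ℕ → ℕ) {s r : ℕ} (hsr : s ≤ r) :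
    ∑ i ∈ Finset.range r, p ^ i * c i ≡ ∑ i ∈ Finset.range s, p ^ i * c i [MOD p ^ s] := by
  induction r, hsr using Nat.le_induction with
  | base => rfl
  | succ r hr ih =>
    rw [Finset.sum_range_succ]
    have h0 : p ^ r * c r ≡ 0 [MOD p ^ s] :=
      (Nat.modEq_zero_iff_dvd).mpr ((pow_dvd_pow p hr).mul_right _)
    simpa using ih.add h0

theorem Nat.sum_range_pow_mul_lt {p : ℕ} {c : ℕ → ℕ} (hc : ∀ i, c i < p) (r : ℕ) :
    ∑ i ∈ Finset.range r, p ^ i * c i < p ^ r := by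
  induction r with
  | zero => simp
  | succ r ih =>
    rw [Finset.sum_range_succ, pow_succ]
    calc _ < p ^ r + p ^ r * c r := by gcongr
      _ = p ^ r * (c r + 1) := by ring
      _ ≤ p ^ r * p := Nat.mul_le_mul_left _ (hc r)

/-- Every family of `p`-adic expansions is realised modulo `n` by some `k < n`. -/
theorem Nat.exists_lt_forall_modEq_sum_range_pow_mul (c : ℕ → ℕ → ℕ) {n : ℕ} (hn : n ≠ 0) :
    ∃ k < n, ∀ p r : ℕ, p.Prime → p ^ r ∣ n →
      k ≡ ∑ i ∈ Finset.range r, p ^ i * c p i [MOD p ^ r] := by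
  obtain ⟨k, hk⟩ := Nat.chineseRemainderOfFinset
    (fun p => ∑ i ∈ Finset.range (n.factorization p), p ^ i * c p i)
    (fun p => p ^ n.factorization p) n.primeFactors
    (fun p hp => pow_ne_zero _ (Nat.prime_of_mem_primeFactors hp).ne_zero)
    (fun p hp q hq hpq => Nat.Coprime.pow _ _ ((Nat.coprime_primes
      (Nat.prime_of_mem_primeFactors hp) (Nat.prime_of_mem_primeFactors hq)).mpr hpq))
  refine ⟨k % n, Nat.mod_lt _ (Nat.pos_of_ne_zero hn), fun p r hp hr => ?_⟩
  rcases Nat.eq_zero_or_pos r with rfl | hr0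
  · simpa using Nat.modEq_one
  have hle : r ≤ n.factorization p := (hp.pow_dvd_iff_le_factorization hn).mp hr
  have hmem : p ∈ n.primeFactors :=
    Nat.mem_primeFactors.mpr ⟨hp, (dvd_pow_self p hr0.ne').trans hr, hn⟩
  exact ((Nat.mod_modEq k n).of_dvd hr).trans
    (((hk p hmem).of_dvd (pow_dvd_pow p hle)).trans (Nat.sum_range_pow_mul_modEq p (c p) hle))

/-- For every family `(f_p)`, indexed by the primes, of functions from the
positive integers to `{0, …, p-1}`, there is exactly one function `f` from the positive
integers to `ℕ` satisfying (*) and (**) such that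
`f (p^r) = f_p 1 + p * f_p 2 + ⋯ + p^(r-1) * f_p r` for every prime `p` and every `r ≥ 1`.
Hence the functions satisfying (*) and (**) correspond one-to-one to such families. -/
theorem existsUnique_function_star_starstar
    (F : ∀ p : ℕ+, (p : ℕ).Prime → ℕ+ → ℕ)
    (hF : ∀ (p : ℕ+) (hp : (p : ℕ).Prime) (n : ℕ+), F p hp n < (p : ℕ)) :
    ∃! f : ℕ+ → ℕ,
      (∀ n : ℕ+, f n ≤ (n : ℕ) - 1) ∧
      (∀ m n : ℕ+, f n = f (m * n) % (n : ℕ)) ∧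
      (∀ (p : ℕ+) (hp : (p : ℕ).Prime) (r : ℕ+),
        f (p ^ (r : ℕ)) =
          ∑ i ∈ Finset.range (r : ℕ), (p : ℕ) ^ i * F p hp ⟨i + 1, Nat.succ_pos i⟩) := by
  let c : ℕ → ℕ → ℕ := fun p i =>
    if h : p.Prime then F ⟨p, h.pos⟩ h ⟨i + 1, Nat.succ_pos i⟩ else 0
  have hcF : ∀ (p : ℕ+) (hp : (p : ℕ).Prime) (i : ℕ),
      c p i = F p hp ⟨i + 1, Nat.succ_pos i⟩ := fun p hp i => dif_pos hp
  have hsum : ∀ (p : ℕ+) (hp : (p : ℕ).Prime) (r : ℕ),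
      ∑ i ∈ Finset.range r, (p : ℕ) ^ i * F p hp ⟨i + 1, Nat.succ_pos i⟩ =
        ∑ i ∈ Finset.range r, (p : ℕ) ^ i * c p i := fun p hp r => by simp only [hcF p hp]
  choose f hlt hf using fun n : ℕ+ =>
    Nat.exists_lt_forall_modEq_sum_range_pow_mul c n.pos.ne'
  refine ⟨f, ⟨fun n => Nat.le_sub_one_of_lt (hlt n), fun m n => ?_, fun p hp r => ?_⟩, ?_⟩
  · have h : f n ≡ f (m * n) [MOD n] := Nat.modEq_of_forall_prime_pow fun p r hp hr =>
      (hf n p r hp hr).trans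
        (hf (m * n) p r hp (by rw [PNat.mul_coe]; exact hr.mul_left _)).symm
    exact (Nat.mod_eq_of_lt (hlt n)).symm.trans h
  · rw [hsum p hp r]
    have hpow : ((p ^ (r : ℕ) : ℕ+) : ℕ) = (p : ℕ) ^ (r : ℕ) := PNat.pow_coe p r
    refine (hf (p ^ (r : ℕ)) p r hp hpow.symm.dvd).eq_of_lt_of_lt
      ((hlt _).trans_eq hpow) (Nat.sum_range_pow_mul_lt (fun i => ?_) _)
    rw [hcF p hp]
    exact hF p hp _
  · rintro g ⟨hgle, hgmod, hgpow⟩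
    funext n
    have hglt : g n < n := (hgle n).trans_lt (Nat.sub_lt n.pos one_pos)
    refine (Nat.modEq_of_forall_prime_pow fun p r hp hr => ?_).eq_of_lt_of_lt hglt (hlt n)
    refine Nat.ModEq.trans ?_ (hf n p r hp hr).symm
    rcases Nat.eq_zero_or_pos r with rfl | hr0
    · simpa using Nat.modEq_one
    lift p to ℕ+ using hp.pos
    lift r to ℕ+ using hr0
    obtain ⟨m, hm⟩ := PNat.dvd_iff.mpr (by rwa [PNat.pow_coe] : ((p ^ (r : ℕ) : ℕ+) : ℕ) ∣ n)
    have h := hgmod m (p ^ (r : ℕ))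
    rw [mul_comm, ← hm, PNat.pow_coe, hgpow p hp r, hsum p hp r] at h
    rw [h]
    exact (Nat.mod_modEq _ _).symm
end

section
/- Let f be a function from the positive integers to ℕ satisfying (*) and (**), and suppose that f(p) ≠ 0 for every prime p. Then for every positive integer n, f(n) and n are coprime: gcd(f(n), n) = 1. -/
/-- If `f` is a function on the positive integers satisfying (*) and (**), and
`f p ≠ 0` for every prime `p`, then `f n` and `n` are coprime for every positive integer `n`. -/
theorem coprime_of_star_starstar_prime_ne_zero
    (f : ℕ → ℕ)
    (hstar : ∀ n : ℕ, 0 < n → f n ≤ n - 1)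
    (hstarstar : ∀ m n : ℕ, 0 < m → 0 < n → f n = f (m * n) % n)
    (hprime : ∀ p : ℕ, p.Prime → f p ≠ 0) :
    ∀ n : ℕ, 0 < n → Nat.Coprime (f n) n := by
  intro n hn
  refine Nat.coprime_of_dvd fun p hp hpf hpn => hprime p hp ?_
  obtain ⟨m, rfl⟩ := hpn
  rw [hstarstar m p (Nat.pos_of_mul_pos_left hn) hp.pos, mul_comm]
  exact Nat.mod_eq_zero_of_dvd hpf
end

section
/- Let (G,R) be a cyclically ordered group (not necessarily abelian), let H be a symmetric subset of G containing the identity e, and let C = C(e,H) be the c-convex component of H containing e. Then: (1) C is symmetric; (2) C = {h ∈ H : I(e,h) ⊆ H} ∪ {h ∈ H : I(e,h⁻¹) ⊆ H}; (3) if moreover H is a subgroup of G, then C is a subgroup of G, and for every h ∈ H one has h·C = C·h and h·C is the c-convex component C(h,H) of H containing h (i.e. h·C is a c-convex subset of G containing h, contained in H, and containing every c-convex subset of H that contains h). -/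
/-- A cyclic order on a (multiplicative, not necessarily abelian) group: a ternary relation
that is strict, cyclic, such that the induced binary relation at each point is transitive and
total on distinct triples, and which is compatible with two-sided translation. -/
def IsCyclicOrderMul {G : Type*} [Group G] (R : G → G → G → Prop) : Prop :=
  (∀ a b c : G, R a b c → a ≠ b ∧ b ≠ c ∧ c ≠ a) ∧
  (∀ a b c : G, R a b c → R b c a) ∧
  (∀ a b c d : G, R a b c → R a c d → R a b d) ∧
  (∀ a b c : G, a ≠ b → b ≠ c → c ≠ a → R a b c ∨ R a c b) ∧
  (∀ a b c x y : G, R a b c → R (x * a * y) (x * b * y) (x * c * y))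

/-- A subset `J` of a cyclically ordered group is c-convex when for all `g ≠ g'` in `J`, one of
the open intervals `I(g,g') = {x | R g x g'}`, `I(g',g)` is contained in `J`. -/
def IsCConvexSet {G : Type*} [Group G] (R : G → G → G → Prop) (J : Set G) : Prop :=
  ∀ g ∈ J, ∀ g' ∈ J, g ≠ g' → ({x | R g x g'} ⊆ J ∨ {x | R g' x g} ⊆ J)

namespace IsCyclicOrderMul

variable {G : Type*} [Group G] {R : G → G → G → Prop}

theorem rotate (hR : IsCyclicOrderMul R) {a b c : G} (h : R a b c) : R b c a :=
  hR.2.1 a b c h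

theorem trans (hR : IsCyclicOrderMul R) {a b c d : G} (h : R a b c) (h' : R a c d) : R a b d :=
  hR.2.2.1 a b c d h h'

theorem translate (hR : IsCyclicOrderMul R) (x y : G) {a b c : G} (h : R a b c) :
    R (x * a * y) (x * b * y) (x * c * y) :=
  hR.2.2.2.2 a b c x y h

/-- Extending an arc to the left: points between `u` and `v` lie between `a` and `v`
whenever `u` does. -/
theorem trans_right (hR : IsCyclicOrderMul R) {a u v x : G} (h : R a u v) (h' : R u x v) :
    R a x v :=
  hR.rotate (hR.trans (hR.rotate (hR.rotate h)) (hR.rotate (hR.rotate h')))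

theorem not_swap (hR : IsCyclicOrderMul R) {a b c : G} (h : R a b c) : ¬ R a c b :=
  fun h' => (hR.1 _ _ _ (hR.trans h h')).2.1 rfl

theorem one_inv_inv (hR : IsCyclicOrderMul R) {a b : G} (h : R 1 a b) : R 1 b⁻¹ a⁻¹ := by
  obtain ⟨h1a, hab, hb1⟩ := hR.1 _ _ _ h
  refine (hR.2.2.2.1 1 b⁻¹ a⁻¹ ?_ ?_ ?_).resolve_right fun h' => ?_
  · simpa [eq_comm] using hb1
  · simpa [eq_comm] using hab
  · simpa [eq_comm] using h1a
  have h₁ : R b (a⁻¹ * b) 1 := by simpa using hR.translate 1 b h'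
  have h₂ : R a 1 (a * b⁻¹) := by simpa using hR.translate a 1 h'
  have h₃ : R b⁻¹ (a * b⁻¹) 1 := by simpa using hR.translate 1 b⁻¹ h
  have h₄ : R a⁻¹ 1 (a⁻¹ * b) := by simpa using hR.translate a⁻¹ 1 h
  have h₅ : R 1 (a⁻¹ * b) b⁻¹ := hR.trans (hR.rotate h₄) h'
  have h₆ : R 1 b⁻¹ a := hR.trans (hR.rotate (hR.rotate h₃)) (hR.rotate h₂)
  exact hR.not_swap (hR.rotate (hR.rotate h₁)) (hR.trans h₅ (hR.trans h₆ h))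

theorem inv (hR : IsCyclicOrderMul R) {a b c : G} (h : R a b c) : R c⁻¹ b⁻¹ a⁻¹ := by
  have h₁ : R 1 (a⁻¹ * b) (a⁻¹ * c) := by simpa using hR.translate a⁻¹ 1 h
  have h₂ := hR.translate 1 a⁻¹ (hR.one_inv_inv h₁)
  simp only [mul_inv_rev, inv_inv, one_mul, mul_inv_cancel_right] at h₂
  exact hR.rotate h₂

theorem isCConvexSet_arc (hR : IsCyclicOrderMul R) (a b : G) :
    IsCConvexSet R {x | x = a ∨ x = b ∨ R a x b} := by
  have left : ∀ {v}, R a v b → {x | R a x v} ⊆ {x | x = a ∨ x = b ∨ R a x b} :=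
    fun hv _ hx => Or.inr (Or.inr (hR.trans hx hv))
  have right : ∀ {v}, R a v b → {x | R v x b} ⊆ {x | x = a ∨ x = b ∨ R a x b} :=
    fun hv _ hx => Or.inr (Or.inr (hR.trans_right hv hx))
  have whole : {x | R a x b} ⊆ {x | x = a ∨ x = b ∨ R a x b} := fun _ hx => Or.inr (Or.inr hx)
  have mid : ∀ {u v}, R a v b → R a u v → {x | R u x v} ⊆ {x | x = a ∨ x = b ∨ R a x b} :=
    fun hv huv _ hx => left hv (hR.trans_right huv hx)
  rintro u (rfl | rfl | hu) v (rfl | rfl | hv) huv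
  · exact absurd rfl huv
  · exact Or.inl whole
  · exact Or.inl (left hv)
  · exact Or.inr whole
  · exact absurd rfl huv
  · exact Or.inr (right hv)
  · exact Or.inr (left hu)
  · exact Or.inl (right hu)
  · exact (hR.2.2.2.1 a u v (hR.1 _ _ _ hu).1 huv (hR.1 _ _ _ hv).1.symm).imp (mid hv) (mid hu)

theorem isCConvexSet_preimage_translate (hR : IsCyclicOrderMul R) {J : Set G}
    (hJ : IsCConvexSet R J) (a b : G) : IsCConvexSet R ((fun x => a * x * b) ⁻¹' J) :=
  fun g hg g' hg' hne => (hJ _ hg _ hg' (by simpa using hne)).imp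
    (fun h _ hx => h (hR.translate a b hx)) (fun h _ hx => h (hR.translate a b hx))

theorem isCConvexSet_preimage_inv (hR : IsCyclicOrderMul R) {J : Set G}
    (hJ : IsCConvexSet R J) : IsCConvexSet R ((fun x => x⁻¹) ⁻¹' J) :=
  fun g hg g' hg' hne => (hJ _ hg _ hg' (by simpa using hne)).symm.imp
    (fun h _ hx => h (hR.inv hx)) (fun h _ hx => h (hR.inv hx))

end IsCyclicOrderMul

/-- Properties of the c-convex component `C = C(e,H)` of a symmetric subset `H`
containing the identity: (1) `C` is symmetric; (2) `C` is the set of `h ∈ H` such that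
`I(e,h) ⊆ H` or `I(e,h⁻¹) ⊆ H`; (3) if `H` is a subgroup then `C` is a subgroup and for every
`h ∈ H`, `h·C = C·h` is the c-convex component of `H` containing `h`. -/
theorem cConvex_component_properties
    {G : Type*} [Group G] (R : G → G → G → Prop) (hR : IsCyclicOrderMul R)
    (H : Set G) (hsym : ∀ g : G, g ∈ H ↔ g⁻¹ ∈ H) (h1 : (1 : G) ∈ H)
    (C : Set G) (hCconv : IsCConvexSet R C) (hC1 : (1 : G) ∈ C) (hCH : C ⊆ H)
    (hCmax : ∀ J : Set G, IsCConvexSet R J → J ⊆ H → (1 : G) ∈ J → J ⊆ C) :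
    (∀ g : G, g ∈ C ↔ g⁻¹ ∈ C) ∧
    (C = {h : G | h ∈ H ∧ {x | R 1 x h} ⊆ H} ∪ {h : G | h ∈ H ∧ {x | R 1 x h⁻¹} ⊆ H}) ∧
    (((∀ a ∈ H, ∀ b ∈ H, a * b ∈ H) ∧ (∀ a ∈ H, a⁻¹ ∈ H)) →
      ((∀ a ∈ C, ∀ b ∈ C, a * b ∈ C) ∧
        ∀ h ∈ H,
          (fun x => h * x) '' C = (fun x => x * h) '' C ∧
          IsCConvexSet R ((fun x => h * x) '' C) ∧
          h ∈ (fun x => h * x) '' C ∧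
          (fun x => h * x) '' C ⊆ H ∧
          ∀ J : Set G, IsCConvexSet R J → J ⊆ H → h ∈ J → J ⊆ (fun x => h * x) '' C)) := by
  have inv_mem : ∀ g ∈ C, g⁻¹ ∈ C := fun g hg =>
    hCmax _ (hR.isCConvexSet_preimage_inv hCconv) (fun x hx => (hsym x).2 (hCH hx))
      (show (1 : G)⁻¹ ∈ C by simpa using hC1) (show g⁻¹⁻¹ ∈ C by simpa using hg)
  refine ⟨fun g => ⟨inv_mem g, fun hg => by simpa using inv_mem _ hg⟩, ?_, ?_⟩
  · ext h
    constructor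
    · intro hh
      by_cases hne : 1 = h
      · subst hne
        exact Or.inl ⟨h1, fun x hx => absurd rfl (hR.1 _ _ _ hx).2.2⟩
      · refine (hCconv 1 hC1 h hh hne).imp (fun hs => ⟨hCH hh, hs.trans hCH⟩)
          (fun hs => ⟨hCH hh, fun x hx => (hsym x).2 (hCH (hs ?_))⟩)
        simpa using hR.inv hx
    · rintro (⟨hh, hs⟩ | ⟨hh, hs⟩)
      · refine hCmax _ (hR.isCConvexSet_arc 1 h) ?_ (Or.inl rfl) (Or.inr (Or.inl rfl))
        rintro x (rfl | rfl | hx)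
        exacts [h1, hh, hs hx]
      · refine hCmax _ (hR.isCConvexSet_arc h 1) ?_ (Or.inr (Or.inl rfl)) (Or.inl rfl)
        rintro x (rfl | rfl | hx)
        exacts [hh, h1, (hsym x).2 (hs (by simpa using hR.inv hx))]
  · rintro ⟨hmul, hinv⟩
    have conj_mem : ∀ h ∈ H, ∀ x ∈ C, h * x * h⁻¹ ∈ C := fun h hh x hx => by
      refine hCmax _ (hR.isCConvexSet_preimage_translate hCconv h⁻¹ h) (fun y hy => ?_)
        (show h⁻¹ * 1 * h ∈ C by simpa using hC1)
        (show h⁻¹ * (h * x * h⁻¹) * h ∈ C by simpa [mul_assoc] using hx)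
      have := hmul _ (hmul _ hh _ (hCH hy)) _ (hinv _ hh)
      simpa [mul_assoc] using this
    have component : ∀ h ∈ H, ∀ J : Set G, IsCConvexSet R J → J ⊆ H → h ∈ J →
        ∀ y ∈ J, h⁻¹ * y ∈ C := fun h hh J hJ hJH hhJ y hy => by
      refine hCmax _ (hR.isCConvexSet_preimage_translate hJ h 1) (fun z hz => ?_)
        (show h * 1 * 1 ∈ J by simpa using hhJ) (show h * (h⁻¹ * y) * 1 ∈ J by simpa using hy)
      simpa using hmul _ (hinv _ hh) _ (hJH hz)
    refine ⟨fun a ha b hb => ?_, fun h hh => ⟨?_, ?_, ⟨1, hC1, mul_one h⟩, ?_, ?_⟩⟩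
    · simpa using component a⁻¹ (hinv _ (hCH ha)) C hCconv hCH (inv_mem a ha) b hb
    · ext y
      constructor
      · rintro ⟨x, hx, rfl⟩
        exact ⟨h * x * h⁻¹, conj_mem h hh x hx, by simp⟩
      · rintro ⟨x, hx, rfl⟩
        exact ⟨h⁻¹ * x * h, by simpa using conj_mem h⁻¹ (hinv _ hh) x hx, by simp [mul_assoc]⟩
    · have himg : (fun x => h * x) '' C = (fun x => h⁻¹ * x * 1) ⁻¹' C := by simp
      rw [himg]
      exact hR.isCConvexSet_preimage_translate hCconv h⁻¹ 1
    · rintro _ ⟨x, hx, rfl⟩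
      exact hmul _ hh _ (hCH hx)
    · exact fun J hJ hJH hhJ y hy => ⟨h⁻¹ * y, component h hh J hJ hJH hhJ y hy, by simp⟩
end

section
/- For every positive rational number α, the quotient of the additive group ℚ × ℤ by the cyclic subgroup generated by (α,1) is a divisible group: for every (x,m) ∈ ℚ × ℤ and every integer n ≥ 1 there exists (y,k) ∈ ℚ × ℤ such that n·(y,k) − (x,m) is an integer multiple of (α,1). -/
/-- For every positive rational `α`, the quotient of `ℚ × ℤ` by the cyclic
subgroup generated by `(α, 1)` is divisible: for every `(x, m)` and every `n ≥ 1` there is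
`(y, k)` with `n • (y, k) - (x, m)` an integer multiple of `(α, 1)`. -/
theorem quotient_prod_rat_int_divisible (α : ℚ) (hα : 0 < α) :
    ∀ (x : ℚ) (m : ℤ) (n : ℕ), 1 ≤ n →
      ∃ (y : ℚ) (k : ℤ),
        (n • ((y, k) : ℚ × ℤ) - (x, m)) ∈ AddSubgroup.zmultiples ((α, 1) : ℚ × ℤ) := by
  intro x m n hn
  have hn' : (n : ℚ) ≠ 0 := by positivity
  refine ⟨(x - m * α) / n, 0, AddSubgroup.mem_zmultiples_iff.mpr ⟨-m, ?_⟩⟩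
  ext
  · simp
    field_simp
    ring
  · simp
end
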